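/- arXiv:math/0605616 — 3 statements merged into one kernel-verified Lean document; each statement's English description precedes it below -/
import Mathlib

section
/- Let e₁, e₂ denote the standard basis vectors of F₂². For every t ≥ 0, the t-fold double D^t({e₁, e₂}) is a cap of size 2^(t+1) in F₂^(t+2). (In design language: saturated regular designs of resolution IV, with n = N/2 factors, can be obtained by successively doubling the complete 2² factorial.) -/
-- A design with N = 2^d runs and n factors is a Finset of nonzero vectors of F₂^d.
-- The double D(S) ⊆ F₂^(d+1) consists of the vectors (v,0) and (v,1) for v ∈ S,
-- where (v,ε) appends the coordinate ε to v.
def double {d : ℕ} (S : Finset (Fin d → ZMod 2)) : Finset (Fin (d + 1) → ZMod 2) :=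
  S.image (fun v => Fin.snoc v 0) ∪ S.image (fun v => Fin.snoc v 1)

-- The t-fold iterated double.
def iterDouble {d : ℕ} (S : Finset (Fin d → ZMod 2)) : (t : ℕ) → Finset (Fin (d + t) → ZMod 2)
  | 0 => S
  | t + 1 => double (iterDouble S t)

-- m_S(v): the number of unordered pairs {a, b} of distinct elements of S with a + b = v
-- (the number of two-factor interactions in the alias set corresponding to v).
def mcount {d : ℕ} (S : Finset (Fin d → ZMod 2)) (v : Fin d → ZMod 2) : ℕ :=
  ((S.powersetCard 2).filter (fun T => T.sum id = v)).card

-- B_j(S): the number of j-element subsets of S summing to zero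
-- (the number of defining words of length j).
def wordCount {d : ℕ} (S : Finset (Fin d → ZMod 2)) (j : ℕ) : ℕ :=
  ((S.powersetCard j).filter (fun T => T.sum id = 0)).card

-- S is a cap: a set of nonzero vectors no three distinct elements of which sum to zero
-- (i.e. the corresponding design has resolution at least IV).
def IsCap {d : ℕ} (S : Finset (Fin d → ZMod 2)) : Prop :=
  (∀ v ∈ S, v ≠ 0) ∧
    ∀ a ∈ S, ∀ b ∈ S, ∀ c ∈ S, a ≠ b → b ≠ c → a ≠ c → a + b + c ≠ 0

-- S is a maximal cap: no nonzero vector outside S can be added keeping it a cap.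
def IsMaximalCap {d : ℕ} (S : Finset (Fin d → ZMod 2)) : Prop :=
  IsCap S ∧ ∀ w : Fin d → ZMod 2, w ≠ 0 → w ∉ S → ¬ IsCap (insert w S)

-- The 2^{5-1} design with defining relation I = ABCDE, as a subset of F₂⁴.

theorem mem_double {d : ℕ} {S : Finset (Fin d → ZMod 2)} {x : Fin (d + 1) → ZMod 2} :
    x ∈ double S ↔ Fin.init (α := fun _ => ZMod 2) x ∈ S := by
  simp only [double, Finset.mem_union, Finset.mem_image]
  constructor
  · rintro (⟨v, hv, rfl⟩ | ⟨v, hv, rfl⟩) <;> simpa using hv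
  · intro hx
    have key : x (Fin.last d) = 0 ∨ x (Fin.last d) = 1 := by
      generalize x (Fin.last d) = e
      revert e
      decide
    refine key.imp (fun h => ⟨_, hx, ?_⟩) (fun h => ⟨_, hx, ?_⟩) <;>
    · rw [← h]
      exact Fin.snoc_init_self (α := fun _ => ZMod 2) x

theorem card_double {d : ℕ} (S : Finset (Fin d → ZMod 2)) :
    (double S).card = 2 * S.card := by
  have inj (e : ZMod 2) : Function.Injective
      (fun v : Fin d → ZMod 2 => (Fin.snoc v e : Fin (d + 1) → ZMod 2)) := fun u v h =>
    (Fin.snoc_injective2 (α := fun _ => ZMod 2) h).1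
  rw [double, Finset.card_union_of_disjoint, Finset.card_image_of_injective _ (inj 0),
    Finset.card_image_of_injective _ (inj 1), two_mul]
  rw [Finset.disjoint_left]
  intro x hx hy
  obtain ⟨u, -, rfl⟩ := Finset.mem_image.1 hx
  obtain ⟨v, -, h⟩ := Finset.mem_image.1 hy
  exact one_ne_zero (Fin.snoc_injective2 (α := fun _ => ZMod 2) h).2

theorem IsCap.double {d : ℕ} {S : Finset (Fin d → ZMod 2)} (hS : IsCap S) :
    IsCap (double S) := by
  have add_self (u : Fin d → ZMod 2) : u + u = 0 := funext fun i => CharTwo.add_self_eq_zero (u i)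
  refine ⟨fun v hv h => hS.1 _ (mem_double.1 hv) ?_, ?_⟩
  · subst h
    rfl
  intro a ha b hb c hc _ _ _ habc
  rw [mem_double] at ha hb hc
  have h : (Fin.init a + Fin.init b + Fin.init c : Fin d → ZMod 2) = 0 :=
    funext fun i => congrFun habc i.castSucc
  refine hS.2 _ ha _ hb _ hc (fun e => ?_) (fun e => ?_) (fun e => ?_) h
  · rw [e, add_self, zero_add] at h
    exact hS.1 _ hc h
  · rw [e, add_assoc, add_self, add_zero] at h
    exact hS.1 _ ha h
  · rw [e, add_right_comm, add_self, zero_add] at h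
    exact hS.1 _ hb h

theorem IsCap.iterDouble {d : ℕ} {S : Finset (Fin d → ZMod 2)} (hS : IsCap S) (t : ℕ) :
    IsCap (iterDouble S t) := by
  induction t with
  | zero => exact hS
  | succ t ih => exact ih.double

theorem card_iterDouble {d : ℕ} (S : Finset (Fin d → ZMod 2)) (t : ℕ) :
    (iterDouble S t).card = 2 ^ t * S.card := by
  induction t with
  | zero => simp [iterDouble]
  | succ t ih => rw [iterDouble, card_double, ih, pow_succ', mul_assoc]

theorem isCap_pair_single :
    IsCap ({Pi.single 0 1, Pi.single 1 1} : Finset (Fin 2 → ZMod 2)) := by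
  refine ⟨by decide, fun a ha b hb c hc hab hbc hac => ?_⟩
  simp only [Finset.mem_insert, Finset.mem_singleton] at ha hb hc
  grind

-- Successively doubling the complete 2² factorial {e₁, e₂} ⊆ F₂² gives caps with
-- n = N/2 factors: D^t({e₁, e₂}) is a cap of size 2^(t+1) in F₂^(2+t).
theorem iterDouble_complete_factorial (t : ℕ) :
    IsCap (iterDouble ({Pi.single 0 1, Pi.single 1 1} : Finset (Fin 2 → ZMod 2)) t) ∧
      (iterDouble ({Pi.single 0 1, Pi.single 1 1} : Finset (Fin 2 → ZMod 2)) t).card =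
        2 ^ (t + 1) := by
  refine ⟨isCap_pair_single.iterDouble t, ?_⟩
  · rw [card_iterDouble, pow_succ]
    congr 1
end

section
/- Let d ≥ 1, let f : F₂^d → F₂ be a nonzero linear functional, and let S be a Finset with S ⊆ {v ∈ F₂^d : f(v) = 1} and |S| = n. Then (2^(d−1) − 1) · Σ_{v ∈ F₂^d} m_S(v)² ≥ (n(n−1)/2)². (This is the Cauchy–Schwarz lower bound on Σ m_i² for designs obtained by deleting factors from a saturated regular design of resolution IV, which have at most N/2 − 1 = 2^(d−1) − 1 nonzero alias-set counts m_i.) -/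
-- The 2^{5-1} design with defining relation I = ABCDE, as a subset of F₂⁴.

theorem card_filter_linearMap_eq_zero {d : ℕ} (hd : 1 ≤ d)
    {f : (Fin d → ZMod 2) →ₗ[ZMod 2] ZMod 2} (hf : f ≠ 0) :
    (Finset.univ.filter fun v => f v = 0).card = 2 ^ (d - 1) := by
  obtain ⟨w, hw⟩ : ∃ w, f w ≠ 0 := by
    by_contra! h
    exact hf (LinearMap.ext h)
  have hw1 : f w = 1 := Fin.eq_one_of_ne_zero _ hw
  have hcompl : (Finset.univ.filter fun v => f v = 0).card =
      (Finset.univ.filter fun v => ¬ f v = 0).card := by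
    refine Finset.card_bij (fun v _ => v + w) ?_ (fun _ _ _ _ h => add_right_cancel h) ?_
    · intro v hv
      simp_all
    · intro v hv
      refine ⟨v - w, ?_, sub_add_cancel v w⟩
      have hv1 : f v = 1 := Fin.eq_one_of_ne_zero _ (Finset.mem_filter.1 hv).2
      simp [hv1, hw1]
  have htotal := Finset.card_filter_add_card_filter_not (s := Finset.univ) (fun v => f v = 0)
  rw [Finset.card_univ, Fintype.card_fun, ZMod.card, Fintype.card_fin] at htotal
  have hpow : 2 ^ d = 2 * 2 ^ (d - 1) := by rw [← pow_succ', Nat.sub_add_cancel hd]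
  omega

theorem sum_mcount {d : ℕ} (S : Finset (Fin d → ZMod 2)) :
    ∑ v, mcount S v = S.card * (S.card - 1) / 2 := by
  unfold mcount
  rw [← Finset.card_eq_sum_card_fiberwise (fun _ _ => Finset.mem_coe.2 (Finset.mem_univ _)),
    Finset.card_powersetCard, Nat.choose_two_right]

theorem mcount_eq_zero_of_notMem {d : ℕ} {f : (Fin d → ZMod 2) →ₗ[ZMod 2] ZMod 2}
    {S : Finset (Fin d → ZMod 2)} (hS : ∀ v ∈ S, f v = 1) {v : Fin d → ZMod 2}
    (hv : v ∉ (Finset.univ.filter fun v => f v = 0).erase 0) : mcount S v = 0 := by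
  refine Finset.card_eq_zero.2 (Finset.filter_eq_empty_iff.2 ?_)
  rintro T hT rfl
  obtain ⟨hTS, hT2⟩ := Finset.mem_powersetCard.1 hT
  obtain ⟨a, b, hab, rfl⟩ := Finset.card_eq_two.1 hT2
  have ha := hS a (hTS (by simp))
  have hb := hS b (hTS (by simp))
  refine hv (Finset.mem_erase.2 ⟨?_, ?_⟩)
  · rw [Finset.sum_pair hab]
    exact fun h => hab (funext fun i => CharTwo.add_eq_zero.1 (congrFun h i))
  · simp only [Finset.mem_filter, Finset.mem_univ, true_and, Finset.sum_pair hab, id, map_add,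
      ha, hb]
    decide

-- Cauchy–Schwarz lower bound (4.3): a design contained in {v : f v = 1} (a projection of
-- the saturated resolution IV design) has at most 2^(d-1) - 1 nonzero alias counts, so
-- (2^(d-1) - 1) · Σ_v m_S(v)² ≥ (n(n-1)/2)².
theorem sum_sq_mcount_lower_bound (d n : ℕ) (hd : 1 ≤ d)
    (f : (Fin d → ZMod 2) →ₗ[ZMod 2] ZMod 2) (hf : f ≠ 0)
    (S : Finset (Fin d → ZMod 2)) (hS : ∀ v ∈ S, f v = 1) (hcard : S.card = n) :
    (n * (n - 1) / 2) ^ 2 ≤ (2 ^ (d - 1) - 1) * ∑ v : Fin d → ZMod 2, mcount S v ^ 2 := by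
  have hsupp : ∀ v ∈ Finset.univ, v ∉ (Finset.univ.filter fun v => f v = 0).erase 0 →
      mcount S v = 0 := fun v _ hv => mcount_eq_zero_of_notMem hS hv
  have hcardT : ((Finset.univ.filter fun v => f v = 0).erase 0).card = 2 ^ (d - 1) - 1 := by
    rw [Finset.card_erase_of_mem (by simp), card_filter_linearMap_eq_zero hd hf]
  rw [← hcard, ← sum_mcount, ← hcardT, ← Finset.sum_subset (Finset.subset_univ _) hsupp,
    ← Finset.sum_subset (Finset.subset_univ _) fun v hv hvT => by rw [hsupp v hv hvT, sq, mul_zero]]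
  exact sq_sum_le_card_mul_sum_sq
end

section
/- Let d ≥ 5, N = 2^d, and let n satisfy 9 · 2^(d−5) ≤ n ≤ 5 · 2^(d−4). Let S₀ = {e₁, e₂, e₃, e₄, e₁+e₂+e₃+e₄} ⊆ F₂⁴. Suppose S is a Finset of nonzero vectors of F₂^d with |S| = n that has minimum aberration, i.e., for every Finset S' of nonzero vectors of F₂^d with |S'| = n, the sequence (B_1(S), B_2(S), …, B_n(S)) is lexicographically less than or equal to (B_1(S'), B_2(S'), …, B_n(S')). Then S is a projection of the (d−4)-fold double of S₀: there exists a linear automorphism g of F₂^d such that the image of S under g is contained in D^(d−4)(S₀). (In design language: for 9N/32 ≤ n ≤ 5N/16, every minimum aberration design is a projection of the maximal resolution IV design with 5N/16 factors obtained by repeatedly doubling the 2^{5−1} design defined by I = ABCDE.) -/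
-- The 2^{5-1} design with defining relation I = ABCDE, as a subset of F₂⁴.
def fiveHalf : Finset (Fin 4 → ZMod 2) :=
  {Pi.single 0 1, Pi.single 1 1, Pi.single 2 1, Pi.single 3 1,
    Pi.single 0 1 + Pi.single 1 1 + Pi.single 2 1 + Pi.single 3 1}

/-- In characteristic two, `match_scalars` has to be told the scalar ring. -/
theorem eq_of_one_smul {G : Type*} [AddCommGroup G] [Module (ZMod 2) G] {x y : G}
    (h : (1 : ZMod 2) • x = (1 : ZMod 2) • y) : x = y := by
  simpa using h

/-! ### Independent sets of the Clebsch graph -/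

/-- The points of `F₂⁴` at distance two from the origin in the Cayley graph of `fiveHalf`. -/
def fiveDist2 : Finset (Fin 4 → ZMod 2) :=
  Finset.univ.filter fun x => x ≠ 0 ∧ x ∉ fiveHalf

theorem mem_fiveDist2 {x : Fin 4 → ZMod 2} : x ∈ fiveDist2 ↔ x ≠ 0 ∧ x ∉ fiveHalf := by
  simp [fiveDist2]

theorem card_fiveHalf : fiveHalf.card = 5 := by decide +kernel

set_option synthInstance.maxHeartbeats 200000 in
set_option synthInstance.maxSize 1000 in
theorem exists_star_of_quadruple : ∀ y ∈ fiveDist2, ∀ z ∈ fiveDist2, y + z ∈ fiveDist2 →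
    ∀ w ∈ fiveDist2, y + w ∈ fiveDist2 → z + w ∈ fiveDist2 → w ≠ y + z →
    ∃ c ∈ fiveHalf, c + y ∈ fiveHalf ∧ c + z ∈ fiveHalf ∧ c + w ∈ fiveHalf := by
  decide +kernel

theorem exists_star_of_triple : ∀ y ∈ fiveDist2, ∀ z ∈ fiveDist2, y + z ∈ fiveDist2 →
    ∃ c ∈ fiveHalf, c + y ∈ fiveHalf ∧ c + z ∈ fiveHalf := by
  decide +kernel

set_option synthInstance.maxHeartbeats 200000 in
set_option synthInstance.maxSize 1000 in
theorem plane_dominates : ∀ y ∈ fiveDist2, ∀ z ∈ fiveDist2, y + z ∈ fiveDist2 →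
    ∀ u ∈ fiveDist2, u ≠ y ∧ u ≠ z ∧ u ≠ y + z →
    u + y ∈ fiveHalf ∨ u + z ∈ fiveHalf ∨ u + (y + z) ∈ fiveHalf := by
  decide +kernel

theorem plane_not_star : ∀ y ∈ fiveDist2, ∀ z ∈ fiveDist2, y + z ∈ fiveDist2 →
    ∀ c ∈ fiveHalf, c + y ∈ fiveHalf → c + z ∈ fiveHalf → c + (y + z) ∉ fiveHalf := by
  decide +kernel

theorem card_star_inter_le : ∀ d : Fin 4 → ZMod 2, d ≠ 0 →
    (fiveHalf.filter fun x => d + x ∈ fiveHalf).card ≤ 2 := by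
  decide +kernel

theorem exists_sum_three_eq : ∀ Y ∈ fiveHalf.powerset, 4 ≤ Y.card →
    ∀ Z ∈ fiveHalf.powerset, 3 ≤ Z.card → ∀ u : Fin 4 → ZMod 2, u ≠ 0 → ∃ s ∈ fiveHalf, ∃ y ∈ Y, ∃ z ∈ Z, s + y + z = u := by
  decide +kernel

theorem exists_sum_two_eq : ∀ u ∈ fiveDist2, ∃ s ∈ fiveHalf, ∃ s' ∈ fiveHalf, s + s' = u := by
  decide +kernel

/-- `X` is contained in the neighbourhood of `c` in the Cayley graph of `fiveHalf`. -/
def StarAt (X : Finset (Fin 4 → ZMod 2)) (c : Fin 4 → ZMod 2) : Prop :=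
  ∀ x ∈ X, c + x ∈ fiveHalf

theorem StarAt.card_image_le {X : Finset (Fin 4 → ZMod 2)} {c : Fin 4 → ZMod 2}
    (h : StarAt X c) : X.image (c + ·) ⊆ fiveHalf ∧ (X.image (c + ·)).card = X.card :=
  ⟨Finset.image_subset_iff.2 h, Finset.card_image_of_injective _ (add_right_injective c)⟩

theorem StarAt.card_le {X : Finset (Fin 4 → ZMod 2)} {c : Fin 4 → ZMod 2}
    (h : StarAt X c) : X.card ≤ 5 := by
  rw [← h.card_image_le.2, ← card_fiveHalf]
  exact Finset.card_le_card h.card_image_le.1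

theorem StarAt.image_eq {X : Finset (Fin 4 → ZMod 2)} {c : Fin 4 → ZMod 2}
    (h : StarAt X c) (hX : 5 ≤ X.card) : X.image (c + ·) = fiveHalf :=
  Finset.eq_of_subset_of_card_le h.card_image_le.1 (by
    rw [h.card_image_le.2, card_fiveHalf]; exact hX)

theorem StarAt.mem_iff {X : Finset (Fin 4 → ZMod 2)} {c : Fin 4 → ZMod 2}
    (h : StarAt X c) (hX : 5 ≤ X.card) {x : Fin 4 → ZMod 2} : x ∈ X ↔ c + x ∈ fiveHalf := by
  rw [← h.image_eq hX]
  simp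

theorem StarAt.unique {X : Finset (Fin 4 → ZMod 2)} {c c' : Fin 4 → ZMod 2}
    (h : StarAt X c) (h' : StarAt X c') (hX : 3 ≤ X.card) : c = c' := by
  by_contra hne
  have hd : c' + c ≠ 0 := fun h0 => hne (by
    linear_combination (norm := (match_scalars <;> decide)) (1 : ZMod 2) • h0)
  have hsub : X.image (c + ·) ⊆ fiveHalf.filter fun x => (c' + c) + x ∈ fiveHalf := by
    intro y hy
    obtain ⟨x, hx, rfl⟩ := Finset.mem_image.1 hy
    refine Finset.mem_filter.2 ⟨h x hx, ?_⟩
    have : c' + c + (c + x) = c' + x := by apply eq_of_one_smul; match_scalars <;> decide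
    simpa [this] using h' x hx
  have := (Finset.card_le_card hsub).trans (card_star_inter_le _ hd)
  rw [h.card_image_le.2] at this
  omega

theorem StarAt.add_eq_zero {X Y Z : Finset (Fin 4 → ZMod 2)} {a b c : Fin 4 → ZMod 2}
    (hX : StarAt X a) (hY : StarAt Y b) (hZ : StarAt Z c)
    (hX5 : 5 ≤ X.card) (hY4 : 4 ≤ Y.card) (hZ3 : 3 ≤ Z.card)
    (h : ∀ x ∈ X, ∀ y ∈ Y, ∀ z ∈ Z, x + y + z ≠ 0) : a + b + c = 0 := by
  by_contra hu
  obtain ⟨Y', hY', hY'4⟩ := Finset.exists_subset_card_eq (hY.card_image_le.2.symm ▸ hY4)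
  obtain ⟨Z', hZ', hZ'3⟩ := Finset.exists_subset_card_eq (hZ.card_image_le.2.symm ▸ hZ3)
  obtain ⟨s, hs, y, hy, z, hz, hsum⟩ := exists_sum_three_eq Y'
    (Finset.mem_powerset.2 (hY'.trans hY.card_image_le.1)) hY'4.ge Z'
    (Finset.mem_powerset.2 (hZ'.trans hZ.card_image_le.1)) hZ'3.ge _ hu
  rw [← hX.image_eq hX5] at hs
  obtain ⟨x, hx, rfl⟩ := Finset.mem_image.1 hs
  obtain ⟨y, hyY, rfl⟩ := Finset.mem_image.1 (hY' hy)
  obtain ⟨z, hzZ, rfl⟩ := Finset.mem_image.1 (hZ' hz)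
  exact h x hx y hyY z hzZ (by
    linear_combination (norm := (match_scalars <;> decide)) (1 : ZMod 2) • hsum)

/-- An independent set of size at least three in the Clebsch graph is contained in a neighbourhood
or is an affine plane. -/
theorem star_or_plane {X : Finset (Fin 4 → ZMod 2)} (hX : ∀ x ∈ X, ∀ y ∈ X, x + y ∉ fiveHalf)
    (h3 : 3 ≤ X.card) :
    (∃ c, StarAt X c) ∨ ∃ b, ∃ y ∈ fiveDist2, ∃ z ∈ fiveDist2, y + z ∈ fiveDist2 ∧
      ∀ x, x ∈ X ↔ b + x ∈ ({0, y, z, y + z} : Finset (Fin 4 → ZMod 2)) := by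
  have hD : ∀ x ∈ X, ∀ y ∈ X, x ≠ y → x + y ∈ fiveDist2 := fun x hx y hy hne =>
    mem_fiveDist2.2 ⟨fun h0 => hne (by
      linear_combination (norm := (match_scalars <;> decide)) (1 : ZMod 2) • h0), hX x hx y hy⟩
  obtain ⟨b, hb, p, hp, q, hq, hbp, hbq, hpq⟩ := Finset.two_lt_card.1 h3
  have hpq' : (b + p) + (b + q) = p + q := by apply eq_of_one_smul; match_scalars <;> decide
  have hy := hD b hb p hp hbp
  have hz := hD b hb q hq hbq
  have hyz : (b + p) + (b + q) ∈ fiveDist2 := hpq' ▸ hD p hp q hq hpq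
  have hother : ∀ x ∈ X, b + x ≠ 0 → b + x ≠ b + p → b + x ≠ b + q →
      b + x ∈ fiveDist2 ∧ (b + p) + (b + x) ∈ fiveDist2 ∧ (b + q) + (b + x) ∈ fiveDist2 := by
    intro x hx h0 h1 h2
    refine ⟨hD b hb x hx fun h => h0 (by rw [h]; exact ZModModule.add_self x), ?_, ?_⟩
    · rw [show (b + p) + (b + x) = p + x by apply eq_of_one_smul; match_scalars <;> decide]
      exact hD p hp x hx fun h => h1 (by rw [h])
    · rw [show (b + q) + (b + x) = q + x by apply eq_of_one_smul; match_scalars <;> decide]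
      exact hD q hq x hx fun h => h2 (by rw [h])
  by_cases hr : b + ((b + p) + (b + q)) ∈ X
  · right
    refine ⟨b, b + p, hy, b + q, hz, hyz, fun x => ⟨fun hx => ?_, fun hx => ?_⟩⟩
    · simp only [Finset.mem_insert, Finset.mem_singleton]
      by_contra! hne
      obtain ⟨h0, h1, h2, h3⟩ := hne
      obtain ⟨hx0, -, -⟩ := hother x hx h0 h1 h2
      rcases plane_dominates _ hy _ hz hyz _ hx0 ⟨h1, h2, h3⟩ with h | h | h
      · exact hX x hx p hp (by convert h using 1; apply eq_of_one_smul; match_scalars <;> decide)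
      · exact hX x hx q hq (by convert h using 1; apply eq_of_one_smul; match_scalars <;> decide)
      · exact hX x hx _ hr (by convert h using 1; apply eq_of_one_smul; match_scalars <;> decide)
    · simp only [Finset.mem_insert, Finset.mem_singleton] at hx
      rcases hx with h | h | h | h
      · rwa [show x = b by linear_combination (norm := (match_scalars <;> decide)) (1 : ZMod 2) • h]
      · rwa [show x = p by linear_combination (norm := (match_scalars <;> decide)) (1 : ZMod 2) • h]
      · rwa [show x = q by linear_combination (norm := (match_scalars <;> decide)) (1 : ZMod 2) • h]
      · rwa [show x = b + ((b + p) + (b + q)) by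
          linear_combination (norm := (match_scalars <;> decide)) (1 : ZMod 2) • h]
  · left
    obtain ⟨c, hc, hcy, hcz⟩ := exists_star_of_triple _ hy _ hz hyz
    refine ⟨b + c, fun x hx => ?_⟩
    by_cases h0 : b + x = 0
    · rwa [show b + c + x = c by linear_combination (norm := (match_scalars <;> decide)) (1 : ZMod 2) • h0]
    by_cases h1 : b + x = b + p
    · rwa [show b + c + x = c + (b + p) by
        linear_combination (norm := (match_scalars <;> decide)) (1 : ZMod 2) • h1]
    by_cases h2 : b + x = b + q
    · rwa [show b + c + x = c + (b + q) by
        linear_combination (norm := (match_scalars <;> decide)) (1 : ZMod 2) • h2]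
    obtain ⟨hx0, hx1, hx2⟩ := hother x hx h0 h1 h2
    obtain ⟨c', hc', hcy', hcz', hcx'⟩ := exists_star_of_quadruple _ hy _ hz hyz _ hx0 hx1 hx2
      fun h => hr (by
        rwa [show b + ((b + p) + (b + q)) = x by
          linear_combination (norm := (match_scalars <;> decide)) (1 : ZMod 2) • h])
    have hcc : c = c' := by
      refine StarAt.unique (X := {0, b + p, b + q}) ?_ ?_ ?_
      · intro v hv
        simp only [Finset.mem_insert, Finset.mem_singleton] at hv
        rcases hv with rfl | rfl | rfl <;> simpa
      · intro v hv
        simp only [Finset.mem_insert, Finset.mem_singleton] at hv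
        rcases hv with rfl | rfl | rfl <;> simpa
      · rw [Finset.card_eq_three.2 ⟨0, b + p, b + q, (mem_fiveDist2.1 hy).1.symm,
          (mem_fiveDist2.1 hz).1.symm, fun h => hpq (add_left_cancel h), rfl⟩]
    rw [hcc, show b + c' + x = c' + (b + x) by apply eq_of_one_smul; match_scalars <;> decide]
    exact hcx'

/-! ### Fibres of a sum-free set over a copy of `fiveHalf` -/

section Fibres

set_option linter.unusedSectionVars false

variable {W : Type*} [AddCommGroup W] [Module (ZMod 2) W]

/-- The fibres over `W` of a sum-free subset of `F₂⁴ × W` containing `fiveHalf × {0}`. -/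
structure ClebschFibres (F : W → Finset (Fin 4 → ZMod 2)) : Prop where
  fiveHalf_subset : fiveHalf ⊆ F 0
  add_add_ne_zero : ∀ {w w' w'' : W}, w + w' + w'' = 0 →
    ∀ x ∈ F w, ∀ y ∈ F w', ∀ z ∈ F w'', x + y + z ≠ 0

theorem eq_add_of_add_add_eq_zero {G : Type*} [AddCommGroup G] [Module (ZMod 2) G] {x y z : G}
    (h : x + y + z = 0) : z = x + y := by
  linear_combination (norm := (match_scalars <;> decide)) (1 : ZMod 2) • h

theorem mem_plane_or_adj {y z : Fin 4 → ZMod 2} (hy : y ∈ fiveDist2) (hz : z ∈ fiveDist2)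
    (hyz : y + z ∈ fiveDist2) (u : Fin 4 → ZMod 2) :
    u ∈ ({0, y, z, y + z} : Finset (Fin 4 → ZMod 2)) ∨
      ∃ p ∈ ({0, y, z, y + z} : Finset (Fin 4 → ZMod 2)), u + p ∈ fiveHalf := by
  by_cases hu : u ∈ fiveHalf
  · exact Or.inr ⟨0, by simp, by simpa⟩
  by_cases hP : u ∈ ({0, y, z, y + z} : Finset (Fin 4 → ZMod 2))
  · exact Or.inl hP
  right
  simp only [Finset.mem_insert, Finset.mem_singleton, not_or] at hP
  rcases plane_dominates y hy z hz hyz u (mem_fiveDist2.2 ⟨hP.1, hu⟩) hP.2 with h | h | h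
  · exact ⟨y, by simp, h⟩
  · exact ⟨z, by simp, h⟩
  · exact ⟨y + z, by simp, h⟩

theorem card_plane : ∀ y ∈ fiveDist2, ∀ z ∈ fiveDist2, y + z ∈ fiveDist2 →
    ({0, y, z, y + z} : Finset (Fin 4 → ZMod 2)).card = 4 := by
  decide +kernel

theorem not_starAt_plane {y z : Fin 4 → ZMod 2} (hy : y ∈ fiveDist2) (hz : z ∈ fiveDist2)
    (hyz : y + z ∈ fiveDist2) (c : Fin 4 → ZMod 2) :
    ¬ StarAt {0, y, z, y + z} c := by
  intro h
  refine plane_not_star y hy z hz hyz c ?_ (h y (by simp)) (h z (by simp)) (h (y + z) (by simp))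
  simpa using h 0 (by simp)

theorem exists_adj_of_notMem : ∀ x ∉ fiveHalf, ∃ s ∈ fiveHalf, ∃ s' ∈ fiveHalf, s + s' = x := by
  intro x hx
  by_cases h0 : x = 0
  · subst h0
    exact ⟨Pi.single 0 1, by simp [fiveHalf], Pi.single 0 1, by simp [fiveHalf],
      ZModModule.add_self _⟩
  · exact exists_sum_two_eq x (mem_fiveDist2.2 ⟨h0, hx⟩)

namespace ClebschFibres

variable {F : W → Finset (Fin 4 → ZMod 2)}

theorem starAt_zero (hF : ClebschFibres F) : StarAt (F 0) 0 := by
  intro x hx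
  by_contra h
  rw [zero_add] at h
  obtain ⟨s, hs, s', hs', rfl⟩ := exists_adj_of_notMem x h
  exact hF.add_add_ne_zero (by simp) s (hF.fiveHalf_subset hs) s' (hF.fiveHalf_subset hs') _ hx
    (ZModModule.add_self _)

theorem independent (hF : ClebschFibres F) (w : W) : ∀ x ∈ F w, ∀ y ∈ F w, x + y ∉ fiveHalf :=
  fun x hx y hy h => hF.add_add_ne_zero (by rw [ZModModule.add_self, zero_add]) x hx y hy _
    (hF.fiveHalf_subset h) (ZModModule.add_self _)

theorem starAt_or_plane (hF : ClebschFibres F) {w : W} (h : 3 ≤ (F w).card) :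
    (∃ c, StarAt (F w) c) ∨ ∃ b, ∃ y ∈ fiveDist2, ∃ z ∈ fiveDist2, y + z ∈ fiveDist2 ∧
      ∀ x, x ∈ F w ↔ b + x ∈ ({0, y, z, y + z} : Finset (Fin 4 → ZMod 2)) :=
  star_or_plane (hF.independent w) h

theorem card_eq_four_of_plane {X : Finset (Fin 4 → ZMod 2)} {b y z : Fin 4 → ZMod 2}
    (hy : y ∈ fiveDist2) (hz : z ∈ fiveDist2) (hyz : y + z ∈ fiveDist2)
    (h : ∀ x, x ∈ X ↔ b + x ∈ ({0, y, z, y + z} : Finset (Fin 4 → ZMod 2))) : X.card = 4 := by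
  refine Eq.trans ?_ (card_plane y hy z hz hyz)
  refine Finset.card_bij (fun x _ => b + x) (fun x hx => (h x).1 hx)
    (fun x _ x' _ hxx => add_left_cancel hxx) fun p hp => ⟨b + p, (h _).2 ?_, ?_⟩
  · rwa [← add_assoc, ZModModule.add_self, zero_add]
  · rw [← add_assoc, ZModModule.add_self, zero_add]

theorem exists_starAt_of_card_eq_five (hF : ClebschFibres F) {w : W} (h : (F w).card = 5) :
    ∃ c, StarAt (F w) c := by
  rcases hF.starAt_or_plane (w := w) (by omega) with h' | ⟨b, y, hy, z, hz, hyz, hX⟩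
  · exact h'
  · have := card_eq_four_of_plane hy hz hyz hX
    omega

theorem card_le_five (hF : ClebschFibres F) (w : W) : (F w).card ≤ 5 := by
  by_cases h3 : 3 ≤ (F w).card
  · rcases hF.starAt_or_plane h3 with ⟨c, h⟩ | ⟨b, y, hy, z, hz, hyz, hX⟩
    · exact h.card_le
    · rw [card_eq_four_of_plane hy hz hyz hX]
      norm_num
  · omega

theorem starAt_add (hF : ClebschFibres F) {w w' : W} {c c' : Fin 4 → ZMod 2}
    (h : StarAt (F w) c) (h5 : (F w).card = 5) (h' : StarAt (F w') c') (h5' : (F w').card = 5) :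
    StarAt (F (w + w')) (c + c') := by
  intro x hx
  by_contra hn
  obtain ⟨s, hs, s', hs', hss⟩ := exists_adj_of_notMem _ hn
  refine hF.add_add_ne_zero (w := w) (w' := w') (w'' := w + w') (ZModModule.add_self _)
    (c + s) ((h.mem_iff h5.ge).2 ?_) (c' + s') ((h'.mem_iff h5'.ge).2 ?_) x hx ?_
  · rwa [← add_assoc, ZModModule.add_self, zero_add]
  · rwa [← add_assoc, ZModModule.add_self, zero_add]
  · linear_combination (norm := (match_scalars <;> decide)) (1 : ZMod 2) • hss

theorem center_add (hF : ClebschFibres F) {w w' w'' : W} {a b c : Fin 4 → ZMod 2}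
    (hw : w + w' + w'' = 0)
    (ha : StarAt (F w) a) (hb : StarAt (F w') b) (hc : StarAt (F w'') c)
    (ha5 : 5 ≤ (F w).card) (hb4 : 4 ≤ (F w').card) (hc3 : 3 ≤ (F w'').card) :
    a + b + c = 0 :=
  ha.add_eq_zero hb hc ha5 hb4 hc3 (hF.add_add_ne_zero hw)

/-! #### Every point is a sum of two points with full fibres -/

variable [Fintype W]

theorem two_mul_card_add_le [DecidableEq W] (hF : ClebschFibres F)
    (hcard : 9 * Fintype.card W ≤ 2 * ∑ w, (F w).card) :
    2 * ((Finset.univ.filter fun w => (F w).card < 3).card +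
      (Finset.univ.filter fun w => (F w).card < 4).card +
      (Finset.univ.filter fun w => (F w).card < 5).card) ≤ Fintype.card W := by
  have key : ∑ w, ((F w).card + ((if (F w).card < 3 then 1 else 0) +
      (if (F w).card < 4 then 1 else 0) + (if (F w).card < 5 then 1 else 0))) ≤
      ∑ _w : W, 5 := by
    refine Finset.sum_le_sum fun w _ => ?_
    have := hF.card_le_five w
    split_ifs <;> omega
  simp only [Finset.sum_add_distrib, ← Finset.card_filter, Finset.sum_const, Finset.card_univ,
    smul_eq_mul] at key
  omega

theorem exists_translate [DecidableEq W] (p₄ p₃ : W → Prop) [DecidablePred p₄] [DecidablePred p₃]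
    (h : 3 * (Finset.univ.filter fun w => ¬ p₄ w).card +
      2 * (Finset.univ.filter fun w => ¬ p₃ w).card < Fintype.card W) (a b c d : W) :
    ∃ z, p₄ z ∧ p₃ (z + a) ∧ p₄ (z + b) ∧ p₃ (z + c) ∧ p₄ (z + d) := by
  by_contra! hcon
  have htr (p : W → Prop) [DecidablePred p] (a : W) :
      (Finset.univ.filter fun w => ¬ p (w + a)).card = (Finset.univ.filter fun w => ¬ p w).card :=
    Finset.card_bij (fun w _ => w + a) (by simp) (by simp)
      fun w hw => ⟨w - a, by simpa using hw, by simp⟩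
  have hsub : (Finset.univ : Finset W) ⊆ (Finset.univ.filter fun w => ¬ p₄ w) ∪
      (Finset.univ.filter fun w => ¬ p₃ (w + a)) ∪ (Finset.univ.filter fun w => ¬ p₄ (w + b)) ∪
      (Finset.univ.filter fun w => ¬ p₃ (w + c)) ∪
      (Finset.univ.filter fun w => ¬ p₄ (w + d)) := by
    intro w _
    have := hcon w
    simp only [Finset.mem_union, Finset.mem_filter, Finset.mem_univ, true_and]
    tauto
  have h1 := Finset.card_le_card hsub
  have := Finset.card_union_le ((Finset.univ.filter fun w => ¬ p₄ w) ∪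
      (Finset.univ.filter fun w => ¬ p₃ (w + a)) ∪ (Finset.univ.filter fun w => ¬ p₄ (w + b)) ∪
      (Finset.univ.filter fun w => ¬ p₃ (w + c))) (Finset.univ.filter fun w => ¬ p₄ (w + d))
  have := Finset.card_union_le ((Finset.univ.filter fun w => ¬ p₄ w) ∪
      (Finset.univ.filter fun w => ¬ p₃ (w + a)) ∪ (Finset.univ.filter fun w => ¬ p₄ (w + b)))
      (Finset.univ.filter fun w => ¬ p₃ (w + c))
  have := Finset.card_union_le ((Finset.univ.filter fun w => ¬ p₄ w) ∪
      (Finset.univ.filter fun w => ¬ p₃ (w + a))) (Finset.univ.filter fun w => ¬ p₄ (w + b))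
  have := Finset.card_union_le (Finset.univ.filter fun w => ¬ p₄ w)
      (Finset.univ.filter fun w => ¬ p₃ (w + a))
  rw [htr p₃ a] at *
  rw [htr p₃ c, htr p₄ b, htr p₄ d] at *
  rw [Finset.card_univ] at h1
  omega

theorem center_sum_five (hF : ClebschFibres F)
    (hcard : 9 * Fintype.card W ≤ 2 * ∑ w, (F w).card)
    {c : W → Fin 4 → ZMod 2} (hc : ∀ w, StarAt (F w) (c w)) {v w x y z : W}
    (hv : (F v).card = 5) (hw : (F w).card = 5) (hx : (F x).card = 5) (hy : (F y).card = 5)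
    (hz : (F z).card = 5) (h : v + w + x + y + z = 0) :
    c v + c w + c x + c y + c z = 0 := by
  classical
  have hb := hF.two_mul_card_add_le hcard
  have h34 : (Finset.univ.filter fun w => (F w).card < 3).card ≤
      (Finset.univ.filter fun w => (F w).card < 4).card :=
    Finset.card_le_card (Finset.monotone_filter_right _ fun w _ (h : _ < _) => by
      show _ < _; omega)
  have h45 : (Finset.univ.filter fun w => (F w).card < 4).card ≤
      (Finset.univ.filter fun w => (F w).card < 5).card :=
    Finset.card_le_card (Finset.monotone_filter_right _ fun w _ (h : _ < _) => by
      show _ < _; omega)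
  have hpos : 0 < Fintype.card W := Fintype.card_pos
  obtain ⟨u, h0, h1, h2, h3, h4⟩ := exists_translate (fun w => 4 ≤ (F w).card)
    (fun w => 3 ≤ (F w).card) (by simp only [not_le]; omega) v (v + w) (v + w + x) z
  have e1 := hF.center_add (w := v) (w' := u) (w'' := u + v)
    (by apply eq_of_one_smul; match_scalars <;> decide) (hc _) (hc _) (hc _) hv.ge h0 h1
  have e2 := hF.center_add (w := w) (w' := u + (v + w)) (w'' := u + v)
    (by apply eq_of_one_smul; match_scalars <;> decide) (hc _) (hc _) (hc _) hw.ge h2 h1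
  have e3 := hF.center_add (w := x) (w' := u + (v + w)) (w'' := u + (v + w + x))
    (by apply eq_of_one_smul; match_scalars <;> decide) (hc _) (hc _) (hc _) hx.ge h2 h3
  have e4 := hF.center_add (w := y) (w' := u + z) (w'' := u + (v + w + x))
    (by linear_combination (norm := (match_scalars <;> decide)) (1 : ZMod 2) • h)
    (hc _) (hc _) (hc _) hy.ge h4 h3
  have e5 := hF.center_add (w := z) (w' := u) (w'' := u + z)
    (by apply eq_of_one_smul; match_scalars <;> decide) (hc _) (hc _) (hc _) hz.ge h0 (by omega)
  linear_combination (norm := (match_scalars <;> decide)) (1 : ZMod 2) • (e1 + e2 + e3 + e4 + e5)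

theorem exists_hom_of_sums (hF : ClebschFibres F)
    (hcard : 9 * Fintype.card W ≤ 2 * ∑ w, (F w).card)
    (hsum : ∀ w, ∃ y y', (F y).card = 5 ∧ (F y').card = 5 ∧ w = y + y') :
    ∃ C : W →+ (Fin 4 → ZMod 2), ∀ w, StarAt (F w) (C w) := by
  have hstar : ∀ w, ∃ c, StarAt (F w) c := by
    intro w
    obtain ⟨y, y', hy, hy', rfl⟩ := hsum w
    obtain ⟨c, hc⟩ := hF.exists_starAt_of_card_eq_five hy
    obtain ⟨c', hc'⟩ := hF.exists_starAt_of_card_eq_five hy'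
    exact ⟨_, hF.starAt_add hc hy hc' hy'⟩
  choose c hc using hstar
  choose r r' hr hr' hrr using hsum
  have h05 : (F 0).card = 5 := le_antisymm (hF.card_le_five 0)
    (card_fiveHalf ▸ Finset.card_le_card hF.fiveHalf_subset)
  have hc0 : c 0 = 0 := (hc 0).unique hF.starAt_zero (by omega)
  refine ⟨AddMonoidHom.mk' (fun w => c (r w) + c (r' w)) fun w w' => ?_, fun w => ?_⟩
  · obtain ⟨a, b, ha, hb, hab⟩ : ∃ a b, (F a).card = 5 ∧ (F b).card = 5 ∧
        r' w + w' = a + b := ⟨_, _, hr _, hr' _, hrr _⟩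
    have e1 := hF.center_sum_five hcard hc (hr' w) (hr w') (hr' w') ha hb (by
      linear_combination (norm := (match_scalars <;> decide)) (1 : ZMod 2) • (hab + hrr w'))
    have e2 := hF.center_sum_five hcard hc (hr w) ha hb (hr (w + w')) (hr' (w + w')) (by
      linear_combination (norm := (match_scalars <;> decide))
        (1 : ZMod 2) • (hab + hrr w + hrr (w + w')))
    linear_combination (norm := (match_scalars <;> decide)) (1 : ZMod 2) • (e1 + e2)
  · have := hF.starAt_add (hc (r w)) (hr w) (hc (r' w)) (hr' w)
    rwa [← hrr w] at this
/-! #### The points with full fibres miss a translate of themselves -/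

section MissedTranslate

theorem four_le_card_of_missed [DecidableEq W] (hF : ClebschFibres F)
    (hcard : 9 * Fintype.card W ≤ 2 * ∑ w, (F w).card) {g : W}
    (hg : ∀ y, (F y).card = 5 → (F (y + g)).card ≠ 5) :
    (∀ w, 4 ≤ (F w).card) ∧ ∀ w, (F w).card ≠ 5 → (F (w + g)).card = 5 := by
  have hb := hF.two_mul_card_add_le hcard
  set Y := Finset.univ.filter fun w => (F w).card = 5 with hY
  set Y' := Finset.univ.filter fun w => (F w).card < 5 with hY'
  have hYY' : Y.card + Y'.card = Fintype.card W := by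
    have hY'2 : Y' = Finset.univ.filter fun w => ¬ (F w).card = 5 := by
      refine Finset.filter_congr fun w _ => ?_
      have := hF.card_le_five w
      omega
    rw [hY'2, hY, Finset.card_filter_add_card_filter_not, Finset.card_univ]
  have hsub : Y.image (· + g) ⊆ Y' := by
    intro w hw
    obtain ⟨y, hy, rfl⟩ := Finset.mem_image.1 hw
    have h1 := hg y (by simpa [hY] using hy)
    have := hF.card_le_five (y + g)
    simp only [hY', Finset.mem_filter, Finset.mem_univ, true_and]
    omega
  have hci : (Y.image (· + g)).card = Y.card :=
    Finset.card_image_of_injective _ (add_left_injective g)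
  have hle := Finset.card_le_card hsub
  have h4 : (Finset.univ.filter fun w => (F w).card < 4).card = 0 := by omega
  refine ⟨fun w => ?_, fun w hw => ?_⟩
  · rw [Finset.card_eq_zero, Finset.filter_eq_empty_iff] at h4
    exact not_lt.1 (h4 (Finset.mem_univ w))
  · have hwY : w ∈ Y.image (· + g) := by
      rw [Finset.eq_of_subset_of_card_le hsub (by omega)]
      have := hF.card_le_five w
      simp only [hY', Finset.mem_filter, Finset.mem_univ, true_and]
      omega
    obtain ⟨y, hy, rfl⟩ := Finset.mem_image.1 hwY
    rw [add_assoc, ZModModule.add_self, add_zero]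
    simpa [hY] using hy

theorem card_zero (hF : ClebschFibres F) : (F 0).card = 5 :=
  le_antisymm (hF.card_le_five 0) (card_fiveHalf ▸ Finset.card_le_card hF.fiveHalf_subset)

theorem exists_hom_of_missed [DecidableEq W] (hF : ClebschFibres F)
    (hcard : 9 * Fintype.card W ≤ 2 * ∑ w, (F w).card) {g : W}
    (hg : ∀ y, (F y).card = 5 → (F (y + g)).card ≠ 5) (hstar : ∀ w, ∃ c, StarAt (F w) c) :
    ∃ C : W →+ (Fin 4 → ZMod 2), ∀ w, StarAt (F w) (C w) := by
  choose c hc using hstar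
  obtain ⟨h4, -⟩ := hF.four_le_card_of_missed hcard hg
  have htri : ∀ y w, (F y).card = 5 → c (y + w) = c y + c w := fun y w hy =>
    eq_add_of_add_add_eq_zero (hF.center_add (w := y) (w' := w) (w'' := y + w)
      (ZModModule.add_self _) (hc _) (hc _) (hc _) hy.ge (h4 _) ((by norm_num : 3 ≤ 4).trans (h4 _)))
  have hsum : ∀ w, (∃ y y', (F y).card = 5 ∧ (F y').card = 5 ∧ w = y + y') →
      ∀ w', c (w + w') = c w + c w' := by
    rintro _ ⟨y, y', hy, hy', rfl⟩ w'
    rw [add_assoc, htri y _ hy, htri y' _ hy', htri y _ hy, add_assoc]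
  refine ⟨AddMonoidHom.mk' c fun w w' => ?_, hc⟩
  by_cases hw : ∃ y y', (F y).card = 5 ∧ (F y').card = 5 ∧ w = y + y'
  · exact hsum w hw w'
  by_cases hw' : ∃ y y', (F y).card = 5 ∧ (F y').card = 5 ∧ w' = y + y'
  · rw [add_comm, hsum w' hw', add_comm]
  by_cases hww : ∃ y y', (F y).card = 5 ∧ (F y').card = 5 ∧ w + w' = y + y'
  · have := hsum _ hww w
    rw [show w + w' + w = w' by apply eq_of_one_smul; match_scalars <;> decide] at this
    linear_combination (norm := (match_scalars <;> decide)) (1 : ZMod 2) • this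
  exfalso
  have hmiss : ∀ {z}, (¬ ∃ y y', (F y).card = 5 ∧ (F y').card = 5 ∧ z = y + y') →
      ∀ y, (F y).card = 5 → (F (y + z)).card ≠ 5 := fun {z} hz y hy hyz =>
    hz ⟨y, y + z, hy, hyz, by rw [← add_assoc, ZModModule.add_self, zero_add]⟩
  have hw5 : (F w).card ≠ 5 := by simpa using hmiss hw 0 hF.card_zero
  exact hww ⟨0, w + w', hF.card_zero,
    (hF.four_le_card_of_missed hcard (hmiss hw')).2 w hw5, (zero_add _).symm⟩

theorem exists_hom_of_plane [DecidableEq W] (hF : ClebschFibres F)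
    (hcard : 9 * Fintype.card W ≤ 2 * ∑ w, (F w).card) {z : W} (hz : ¬ ∃ c, StarAt (F z) c) :
    ∃ C : W →+ (Fin 4 → ZMod 2), ∃ χ : W →+ ZMod 2, Function.Surjective χ ∧
      ∃ p ∈ fiveDist2, ∃ q ∈ fiveDist2, p + q ∈ fiveDist2 ∧ ∀ w x, x ∈ F w ↔
        (χ w = 0 ∧ C w + x ∈ fiveHalf) ∨
          (χ w = 1 ∧ C w + x ∈ ({0, p, q, p + q} : Finset (Fin 4 → ZMod 2))) := by
  have hmiss : ∀ y, (F y).card = 5 → (F (y + z)).card ≠ 5 := by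
    intro y hy hyz
    obtain ⟨c, hc⟩ := hF.exists_starAt_of_card_eq_five hy
    obtain ⟨c', hc'⟩ := hF.exists_starAt_of_card_eq_five hyz
    refine hz ⟨c + c', ?_⟩
    simpa [← add_assoc, ZModModule.add_self] using hF.starAt_add hc hy hc' hyz
  obtain ⟨h4, hcov⟩ := hF.four_le_card_of_missed hcard hmiss
  obtain ⟨b, p, hp, q, hq, hpq, hplane⟩ :=
    (hF.starAt_or_plane ((by norm_num : 3 ≤ 4).trans (h4 z))).resolve_left hz
  have hstar : ∀ w, ∃ c, (F w).card = 5 → StarAt (F w) c := by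
    intro w
    by_cases hw : (F w).card = 5
    · obtain ⟨c, hc⟩ := hF.exists_starAt_of_card_eq_five hw
      exact ⟨c, fun _ => hc⟩
    · exact ⟨0, fun h => absurd h hw⟩
  choose c hc using hstar
  have htrans : ∀ y, (F y).card = 5 → ∀ x, x ∈ F (y + z) ↔
      c y + b + x ∈ ({0, p, q, p + q} : Finset (Fin 4 → ZMod 2)) := by
    intro y hy
    have hsub : (F (y + z)).image (c y + b + ·) ⊆ {0, p, q, p + q} := by
      intro u hu
      obtain ⟨x, hx, rfl⟩ := Finset.mem_image.1 hu
      refine (mem_plane_or_adj hp hq hpq _).resolve_right ?_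
      rintro ⟨r, hr, hadj⟩
      refine hF.add_add_ne_zero (w := y) (w' := z) (w'' := y + z) (ZModModule.add_self _)
        (b + x + r) (((hc y hy).mem_iff hy.ge).2 ?_) (b + r) ((hplane _).2 ?_) x hx ?_
      · convert hadj using 1
        apply eq_of_one_smul; match_scalars <;> decide
      · rwa [← add_assoc, ZModModule.add_self, zero_add]
      · apply eq_of_one_smul; match_scalars <;> decide
    have heq := Finset.eq_of_subset_of_card_le hsub (by
      rw [card_plane p hp q hq hpq,
        Finset.card_image_of_injective _ (add_right_injective (c y + b))]
      exact h4 _)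
    intro x
    rw [← heq, Finset.mem_image]
    exact ⟨fun h => ⟨x, h, rfl⟩, fun ⟨x', hx', h⟩ => add_left_cancel h ▸ hx'⟩
  have hclosed : ∀ y y', (F y).card = 5 → (F y').card = 5 → (F (y + y')).card = 5 := by
    intro y y' hy hy'
    by_contra hn
    have h5 := hcov _ hn
    have hpl := htrans _ h5
    rw [show y + y' + z + z = y + y' by rw [add_assoc, ZModModule.add_self, add_zero]] at hpl
    have hst := hF.starAt_add (hc y hy) hy (hc y' hy') hy'
    refine not_starAt_plane hp hq hpq (c y + c y' + (c (y + y' + z) + b)) fun x hx => ?_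
    have : c (y + y' + z) + b + x ∈ F (y + y') := (hpl _).2 (by
      rwa [← add_assoc, ZModModule.add_self, zero_add])
    rw [add_assoc]
    exact hst _ this
  have hcadd : ∀ y y', (F y).card = 5 → (F y').card = 5 → c (y + y') = c y + c y' := by
    intro y y' hy hy'
    have hyy := hclosed y y' hy hy'
    exact eq_add_of_add_add_eq_zero (hF.center_add (w := y) (w' := y') (w'' := y + y')
      (ZModModule.add_self _) (hc _ hy) (hc _ hy') (hc _ hyy) (by omega) (by omega) (by omega))
  have hmixed : ∀ y w, (F y).card = 5 → (F w).card ≠ 5 → (F (y + w)).card ≠ 5 := by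
    intro y w hy hw hyw
    refine hw ?_
    simpa [← add_assoc, ZModModule.add_self] using hclosed y (y + w) hy hyw
  have hsame : ∀ w w', (F w).card ≠ 5 → (F w').card ≠ 5 → (F (w + w')).card = 5 := by
    intro w w' hw hw'
    have := hclosed _ _ (hcov w hw) (hcov w' hw')
    rwa [show w + z + (w' + z) = w + w' by
      apply eq_of_one_smul; match_scalars <;> decide] at this
  let C : W →+ (Fin 4 → ZMod 2) := AddMonoidHom.mk'
    (fun w => if (F w).card = 5 then c w else c (w + z) + b) (by
      intro w w'
      by_cases hw : (F w).card = 5 <;> by_cases hw' : (F w').card = 5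
      · simp only [hw, hw', hclosed w w' hw hw', if_true]
        exact hcadd w w' hw hw'
      · simp only [hw, hw', hmixed w w' hw hw', if_true, if_false]
        rw [add_assoc w, hcadd _ _ hw (hcov w' hw'), add_assoc]
      · simp only [hw, hw', add_comm w w', hmixed w' w hw' hw, if_true, if_false]
        rw [add_assoc w', hcadd _ _ hw' (hcov w hw)]
        abel
      · simp only [hw, hw', hsame w w' hw hw', if_true, if_false]
        have := hcadd _ _ (hcov w hw) (hcov w' hw')
        rw [show w + z + (w' + z) = w + w' by
          apply eq_of_one_smul; match_scalars <;> decide] at this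
        linear_combination (norm := (match_scalars <;> decide)) (1 : ZMod 2) • this)
  let χ : W →+ ZMod 2 := AddMonoidHom.mk' (fun w => if (F w).card = 5 then 0 else 1) (by
      intro w w'
      by_cases hw : (F w).card = 5 <;> by_cases hw' : (F w').card = 5
      · simp [hw, hw', hclosed w w' hw hw']
      · simp [hw, hw', hmixed w w' hw hw']
      · simp [hw, hw', add_comm w w', hmixed w' w hw' hw]
      · simp only [hw, hw', hsame w w' hw hw', if_true, if_false]
        decide)
  have hz5 : (F z).card ≠ 5 := by simpa using hmiss 0 hF.card_zero
  have hχ (w : W) : χ w = if (F w).card = 5 then 0 else 1 := rfl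
  have hC (w : W) : C w = if (F w).card = 5 then c w else c (w + z) + b := rfl
  refine ⟨C, χ, fun a => ?_, p, hp, q, hq, hpq, fun w x => ?_⟩
  · fin_cases a
    · exact ⟨0, map_zero χ⟩
    · exact ⟨z, by rw [hχ, if_neg hz5]; rfl⟩
  · by_cases hw : (F w).card = 5
    · simpa [hχ, hC, hw] using (hc w hw).mem_iff hw.ge
    · have := htrans _ (hcov w hw) x
      rw [add_assoc w, ZModModule.add_self, add_zero] at this
      simpa [hχ, hC, hw] using this

end MissedTranslate

/-- The fibres of a sum-free set of density at least `9 / 32` are compatible with a translation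
homomorphism. -/
theorem exists_hom [DecidableEq W] (hF : ClebschFibres F)
    (hcard : 9 * Fintype.card W ≤ 2 * ∑ w, (F w).card) :
    (∃ C : W →+ (Fin 4 → ZMod 2), ∀ w, StarAt (F w) (C w)) ∨
    ∃ C : W →+ (Fin 4 → ZMod 2), ∃ χ : W →+ ZMod 2, Function.Surjective χ ∧
      ∃ p ∈ fiveDist2, ∃ q ∈ fiveDist2, p + q ∈ fiveDist2 ∧ ∀ w x, x ∈ F w ↔
        (χ w = 0 ∧ C w + x ∈ fiveHalf) ∨
          (χ w = 1 ∧ C w + x ∈ ({0, p, q, p + q} : Finset (Fin 4 → ZMod 2))) := by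
  by_cases hsum : ∀ w, ∃ y y', (F y).card = 5 ∧ (F y').card = 5 ∧ w = y + y'
  · exact Or.inl (hF.exists_hom_of_sums hcard hsum)
  by_cases hstar : ∀ w, ∃ c, StarAt (F w) c
  · push Not at hsum
    obtain ⟨g, hg⟩ := hsum
    refine Or.inl (hF.exists_hom_of_missed hcard (g := g) (fun y hy hyg => ?_) hstar)
    exact hg y (y + g) hy hyg (by rw [← add_assoc, ZModModule.add_self, zero_add])
  · push Not at hstar
    obtain ⟨z, hz⟩ := hstar
    exact Or.inr (hF.exists_hom_of_plane hcard (z := z) (by push Not; exact hz))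

end ClebschFibres

end Fibres

/-! ### Short odd circuits in dense sum-free sets -/

section OddCircuit

variable {G : Type*} [AddCommGroup G] [Module (ZMod 2) G]

theorem sum_symmDiff_eq {ι M : Type*} [DecidableEq ι] [AddCommGroup M] [Module (ZMod 2) M]
    (s t : Finset ι) (f : ι → M) :
    ∑ i ∈ symmDiff s t, f i = ∑ i ∈ s, f i + ∑ i ∈ t, f i := by
  have h1 := Finset.sum_inter_add_sum_sdiff s t f
  have h2 := Finset.sum_inter_add_sum_sdiff t s f
  rw [Finset.inter_comm] at h2
  have h3 : ∑ i ∈ symmDiff s t, f i = ∑ i ∈ s \ t, f i + ∑ i ∈ t \ s, f i :=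
    Finset.sum_union disjoint_sdiff_sdiff
  rw [h3, ← h1, ← h2]
  apply eq_of_one_smul; match_scalars <;> decide

theorem odd_card_symmDiff {ι : Type*} [DecidableEq ι] {s : Finset ι} (hs : Odd s.card) (a b : ι) :
    Odd (symmDiff (symmDiff s {a}) {b}).card := by
  have h := sum_symmDiff_eq (symmDiff s {a}) {b} fun _ => (1 : ZMod 2)
  rw [sum_symmDiff_eq s {a}] at h
  simp only [Finset.sum_const, nsmul_eq_mul, mul_one, Finset.card_singleton, Nat.cast_one] at h
  rw [← ZMod.natCast_eq_one_iff_odd] at hs ⊢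
  rw [h, hs]
  decide

theorem card_symmDiff_singleton_le {ι : Type*} [DecidableEq ι] (s : Finset ι) (a : ι) :
    (symmDiff s {a}).card ≤ s.card + 1 :=
  (Finset.card_le_card (symmDiff_le_sup (a := s) (b := {a}))).trans
    ((Finset.card_union_le _ _).trans (by simp))

/-- Either a linear functional is identically one on `A`, or an odd number of elements of `A` sum
to zero. -/
theorem exists_functional_or_odd [DecidableEq G] (A : Finset G) :
    (∃ f : G →ₗ[ZMod 2] ZMod 2, ∀ a ∈ A, f a = 1) ∨
      ∃ T ⊆ A, Odd T.card ∧ ∑ x ∈ T, x = 0 := by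
  let P : Submodule (ZMod 2) (G × ZMod 2) :=
    Submodule.span (ZMod 2) ((fun a => (a, (1 : ZMod 2))) '' (A : Set G))
  have hP : ∀ p ∈ P, ∃ T ⊆ A, ∑ a ∈ T, (a, (1 : ZMod 2)) = p := by
    intro p hp
    induction hp using Submodule.span_induction with
    | mem x hx =>
      obtain ⟨a, ha, rfl⟩ := hx
      exact ⟨{a}, by simpa using ha, by simp⟩
    | zero => exact ⟨∅, by simp, by simp⟩
    | add x y _ _ hx hy =>
      obtain ⟨T, hT, rfl⟩ := hx
      obtain ⟨U, hU, rfl⟩ := hy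
      exact ⟨symmDiff T U, symmDiff_le_sup.trans (Finset.union_subset hT hU),
        sum_symmDiff_eq _ _ _⟩
    | smul c x _ hx =>
      obtain ⟨T, hT, rfl⟩ := hx
      obtain rfl | rfl : c = 0 ∨ c = 1 := by revert c; decide
      · exact ⟨∅, by simp, by simp⟩
      · exact ⟨T, hT, by simp⟩
  by_cases h : ((0, 1) : G × ZMod 2) ∈ P
  · right
    obtain ⟨T, hT, hsum⟩ := hP _ h
    have h1 := congrArg Prod.fst hsum
    have h2 := congrArg Prod.snd hsum
    rw [Prod.fst_sum] at h1
    rw [Prod.snd_sum] at h2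
    refine ⟨T, hT, ?_, h1⟩
    rw [← ZMod.natCast_eq_one_iff_odd]
    simpa using h2
  · left
    obtain ⟨g, hg, hgP⟩ := Submodule.exists_le_ker_of_notMem h
    have hone : ∀ x : ZMod 2, x ≠ 0 → x = 1 := by decide
    refine ⟨g ∘ₗ LinearMap.inl (ZMod 2) G (ZMod 2), fun a ha => hone _ fun h0 => hg ?_⟩
    have h1 : g (a, 1) = 0 := hgP (Submodule.subset_span ⟨a, ha, rfl⟩)
    have h2 : ((a, 1) : G × ZMod 2) = (a, 0) + (0, 1) := by simp
    rw [h2, map_add] at h1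
    simpa [show g (a, 0) = 0 from h0] using h1

theorem card_union_translate [DecidableEq G] (A : Finset G) (q : G)
    (h : ∀ a ∈ A, ∀ a' ∈ A, a + a' ≠ q) : (A ∪ A.image (q + ·)).card = 2 * A.card := by
  rw [Finset.card_union_of_disjoint, Finset.card_image_of_injective _ (add_right_injective q),
    two_mul]
  rw [Finset.disjoint_left]
  intro a ha ha'
  obtain ⟨b, hb, rfl⟩ := Finset.mem_image.1 ha'
  exact h _ ha b hb (by rw [add_assoc, ZModModule.add_self, add_zero])

theorem exists_five_circuit [Fintype G] [DecidableEq G] {A : Finset G}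
    (hA : ∀ a ∈ A, ∀ b ∈ A, ∀ c ∈ A, a + b + c ≠ 0) (hcard : Fintype.card G < 4 * A.card)
    (hodd : ∃ T ⊆ A, Odd T.card ∧ ∑ x ∈ T, x = 0) :
    ∃ T ⊆ A, T.card = 5 ∧ ∑ x ∈ T, x = 0 := by
  obtain ⟨T, hT, hmin⟩ := Finset.exists_min_image
    (A.powerset.filter fun T => Odd T.card ∧ ∑ x ∈ T, x = 0) Finset.card (by
      obtain ⟨T, hT⟩ := hodd
      exact ⟨T, by simpa using hT⟩)
  simp only [Finset.mem_filter, Finset.mem_powerset] at hT hmin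
  obtain ⟨hTA, hTodd, hTsum⟩ := hT
  refine ⟨T, hTA, ?_, hTsum⟩
  have h1 : T.card ≠ 1 := by
    intro h
    obtain ⟨x, rfl⟩ := Finset.card_eq_one.1 h
    have hx : x ∈ A := hTA (by simp)
    rw [Finset.sum_singleton] at hTsum
    exact hA x hx x hx x hx (by simp [hTsum])
  have h3 : T.card ≠ 3 := by
    intro h
    obtain ⟨x, y, z, hxy, hxz, hyz, rfl⟩ := Finset.card_eq_three.1 h
    refine hA x (hTA (by simp)) y (hTA (by simp)) z (hTA (by simp)) ?_
    rwa [Finset.sum_insert (by simp [hxy, hxz]), Finset.sum_pair hyz, ← add_assoc] at hTsum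
  by_contra h5
  have h7 : 6 ≤ T.card := by
    obtain ⟨k, hk⟩ := hTodd
    omega
  have key : ∀ X ⊆ T, ∀ Y ⊆ T, Disjoint X Y → X.card = 2 → Y.card = 2 →
      ∀ a ∈ A, ∀ a' ∈ A, a + a' ≠ ∑ x ∈ X, x + ∑ x ∈ Y, x := by
    intro X hX Y hY hXY hX2 hY2 a ha a' ha' h
    have hU : X ∪ Y ⊆ T := Finset.union_subset hX hY
    have hUc : (X ∪ Y).card = 4 := by rw [Finset.card_union_of_disjoint hXY, hX2, hY2]
    have hdc : (T \ (X ∪ Y)).card = T.card - 4 := by rw [Finset.card_sdiff_of_subset hU, hUc]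
    have hdsum : ∑ x ∈ T \ (X ∪ Y), x = a + a' := by
      have := Finset.sum_sdiff hU (f := fun x => x)
      rw [hTsum, Finset.sum_union hXY, ← h] at this
      linear_combination (norm := (match_scalars <;> decide)) (1 : ZMod 2) • this
    have hle := hmin (symmDiff (symmDiff (T \ (X ∪ Y)) {a}) {a'}) ⟨?_, ?_, ?_⟩
    · have := card_symmDiff_singleton_le (T \ (X ∪ Y)) a
      have := card_symmDiff_singleton_le (symmDiff (T \ (X ∪ Y)) {a}) a'
      omega
    · refine symmDiff_le_sup.trans (Finset.union_subset (symmDiff_le_sup.trans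
        (Finset.union_subset (Finset.sdiff_subset.trans hTA) ?_)) ?_) <;> simpa
    · refine odd_card_symmDiff ?_ a a'
      rw [hdc]
      exact Nat.Odd.sub_even (by omega) hTodd (by decide)
    · rw [sum_symmDiff_eq, sum_symmDiff_eq, hdsum, Finset.sum_singleton, Finset.sum_singleton,
        add_assoc, ZModModule.add_self]
  obtain ⟨T', hT', hT'c⟩ := Finset.exists_subset_card_eq h7
  obtain ⟨X, hX, hXc⟩ := Finset.exists_subset_card_eq (s := T') (n := 2) (by omega)
  obtain ⟨Y, hY, hYc⟩ := Finset.exists_subset_card_eq (s := T' \ X) (n := 2) (by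
    rw [Finset.card_sdiff_of_subset hX]; omega)
  have hZc : ((T' \ X) \ Y).card = 2 := by
    rw [Finset.card_sdiff_of_subset hY, Finset.card_sdiff_of_subset hX]; omega
  set Z := (T' \ X) \ Y with hZ
  have hXY : Disjoint X Y := Finset.disjoint_of_subset_right hY Finset.disjoint_sdiff
  have hXZ : Disjoint X Z :=
    Finset.disjoint_of_subset_right Finset.sdiff_subset Finset.disjoint_sdiff
  have hYZ : Disjoint Y Z := Finset.disjoint_sdiff
  have hXT := hX.trans hT'
  have hYT := (hY.trans Finset.sdiff_subset).trans hT'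
  have hZT : Z ⊆ T := ((Finset.sdiff_subset).trans Finset.sdiff_subset).trans hT'
  have hB := card_union_translate A _ (key X hXT Y hYT hXY hXc hYc)
  have hB' := card_union_translate (A ∪ A.image (∑ x ∈ X, x + ∑ x ∈ Y, x + ·))
    (∑ x ∈ X, x + ∑ x ∈ Z, x) (by
      have hk1 := key X hXT Z hZT hXZ hXc hZc
      have hk2 := key Y hYT Z hZT hYZ hYc hZc
      intro b hb b' hb' h
      rcases Finset.mem_union.1 hb with hb | hb <;> rcases Finset.mem_union.1 hb' with hb' | hb'
      · exact hk1 b hb b' hb' h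
      · obtain ⟨a, ha, rfl⟩ := Finset.mem_image.1 hb'
        refine hk2 b hb a ha ?_
        linear_combination (norm := (match_scalars <;> decide)) (1 : ZMod 2) • h
      · obtain ⟨a, ha, rfl⟩ := Finset.mem_image.1 hb
        refine hk2 a ha b' hb' ?_
        linear_combination (norm := (match_scalars <;> decide)) (1 : ZMod 2) • h
      · obtain ⟨a, ha, rfl⟩ := Finset.mem_image.1 hb
        obtain ⟨a', ha', rfl⟩ := Finset.mem_image.1 hb'
        refine hk1 a ha a' ha' ?_
        linear_combination (norm := (match_scalars <;> decide)) (1 : ZMod 2) • h)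
  have := Finset.card_le_univ ((A ∪ A.image (∑ x ∈ X, x + ∑ x ∈ Y, x + ·)) ∪
    (A ∪ A.image (∑ x ∈ X, x + ∑ x ∈ Y, x + ·)).image (∑ x ∈ X, x + ∑ x ∈ Z, x + ·))
  omega

theorem exists_embedding_of_five_circuit [DecidableEq G] {A : Finset G}
    (hA : ∀ a ∈ A, ∀ b ∈ A, ∀ c ∈ A, a + b + c ≠ 0)
    (h : ∃ T ⊆ A, T.card = 5 ∧ ∑ x ∈ T, x = 0) :
    ∃ φ : (Fin 4 → ZMod 2) →ₗ[ZMod 2] G, Function.Injective φ ∧ ∀ x ∈ fiveHalf, φ x ∈ A := by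
  obtain ⟨T, hTA, hT5, hTsum⟩ := h
  let e := T.equivFinOfCardEq hT5
  let s : Fin 5 → G := fun i => (e.symm i : G)
  have hsT : Finset.univ.image s = T := by
    ext x
    simp only [Finset.mem_image, Finset.mem_univ, true_and]
    exact ⟨fun ⟨i, hi⟩ => hi ▸ (e.symm i).2, fun hx => ⟨e ⟨x, hx⟩, by simp [s]⟩⟩
  have hsum : ∑ i, s i = 0 := by
    rw [← hTsum, ← Finset.sum_coe_sort T, ← Equiv.sum_comp e.symm]
  let φ := Fintype.linearCombination (ZMod 2) fun i : Fin 4 => s i.castSucc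
  have hφ (i : Fin 4) : φ (Pi.single i 1) = s i.castSucc := by
    simp [φ, Fintype.linearCombination_apply_single]
  have himg : fiveHalf.image φ = T := by
    have h4 : s 0 + s 1 + s 2 + s 3 = s 4 := by
      rw [Fin.sum_univ_five] at hsum
      linear_combination (norm := (match_scalars <;> decide)) (1 : ZMod 2) • hsum
    rw [← hsT]
    simp only [fiveHalf, Finset.image_insert, Finset.image_singleton, map_add, hφ]
    rw [show (Finset.univ : Finset (Fin 5)) = {0, 1, 2, 3, 4} from rfl]
    simp only [Finset.image_insert, Finset.image_singleton]
    rw [← h4]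
    rfl
  have hinj : Set.InjOn φ fiveHalf :=
    Finset.card_image_iff.1 (by rw [himg, hT5, card_fiveHalf])
  have hmem : ∀ x ∈ fiveHalf, φ x ∈ A := fun x hx =>
    hTA (himg ▸ Finset.mem_image_of_mem φ hx)
  refine ⟨φ, (injective_iff_map_eq_zero φ).2 fun x hx => ?_, hmem⟩
  by_contra h0
  by_cases hx5 : x ∈ fiveHalf
  · exact hA _ (hmem x hx5) _ (hmem x hx5) _ (hmem x hx5) (by simp [hx])
  obtain ⟨y, hy, z, hz, rfl⟩ := exists_adj_of_notMem x hx5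
  rw [map_add] at hx
  refine h0 ?_
  rw [hinj hy hz (by linear_combination (norm := (match_scalars <;> decide)) (1 : ZMod 2) • hx)]
  exact ZModModule.add_self z

end OddCircuit

/-! ### Structure of dense sum-free sets -/

section Structure

variable {G : Type*} [AddCommGroup G] [Module (ZMod 2) G]

/-- The sum-free set of density `9 / 32` whose fibres are `fiveHalf` and an affine plane. -/
def starPlane (p q : Fin 4 → ZMod 2) : Finset ((Fin 4 → ZMod 2) × ZMod 2) :=
  Finset.univ.filter fun x => (x.2 = 0 ∧ x.1 ∈ fiveHalf) ∨
    (x.2 = 1 ∧ x.1 ∈ ({0, p, q, p + q} : Finset (Fin 4 → ZMod 2)))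

/-- The coordinates of `G` given by a copy of `F₂⁴` and a complement of it. -/
theorem exists_equiv_prod_ker {φ : (Fin 4 → ZMod 2) →ₗ[ZMod 2] G}
    (hφ : Function.Injective φ) :
    ∃ ψ : G →ₗ[ZMod 2] (Fin 4 → ZMod 2), ∃ e : ((Fin 4 → ZMod 2) × LinearMap.ker ψ) ≃ G,
      ∃ ρ : G →ₗ[ZMod 2] LinearMap.ker ψ, (∀ p, e p = φ p.1 + p.2) ∧
        (∀ p, ψ (e p) = p.1) ∧ ∀ p, ρ (e p) = p.2 := by
  obtain ⟨ψ, hψ⟩ := φ.exists_leftInverse_of_injective (LinearMap.ker_eq_bot.2 hφ)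
  have hψ' (x) : ψ (φ x) = x := LinearMap.congr_fun hψ x
  let ρ : G →ₗ[ZMod 2] LinearMap.ker ψ :=
    (LinearMap.id - φ ∘ₗ ψ).codRestrict _ fun g => by simp [hψ']
  have hρ (g) : (ρ g : G) = g - φ (ψ g) := rfl
  have h1 (v : Fin 4 → ZMod 2) (w : LinearMap.ker ψ) : ψ (φ v + w) = v := by
    rw [map_add, hψ', LinearMap.mem_ker.1 w.2, add_zero]
  have h2 (v : Fin 4 → ZMod 2) (w : LinearMap.ker ψ) : ρ (φ v + w) = w := by
    ext
    rw [hρ, h1, add_sub_cancel_left]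
  refine ⟨ψ, ⟨fun p => φ p.1 + p.2, fun g => (ψ g, ρ g), fun p => ?_, fun g => ?_⟩, ρ,
    fun p => rfl, fun p => h1 _ _, fun p => h2 _ _⟩
  · exact Prod.ext (h1 _ _) (h2 _ _)
  · simp [hρ]

theorem structure_of_embedding [Fintype G] [DecidableEq G] {A : Finset G}
    (hA : ∀ a ∈ A, ∀ b ∈ A, ∀ c ∈ A, a + b + c ≠ 0) (hcard : 9 * Fintype.card G ≤ 32 * A.card)
    {φ : (Fin 4 → ZMod 2) →ₗ[ZMod 2] G} (hφ : Function.Injective φ)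
    (hφA : ∀ x ∈ fiveHalf, φ x ∈ A) :
    (∃ π : G →ₗ[ZMod 2] (Fin 4 → ZMod 2), Function.Surjective π ∧ ∀ a ∈ A, π a ∈ fiveHalf) ∨
      ∃ π : G →ₗ[ZMod 2] (Fin 4 → ZMod 2) × ZMod 2, Function.Surjective π ∧
        ∃ p ∈ fiveDist2, ∃ q ∈ fiveDist2, p + q ∈ fiveDist2 ∧ ∀ g, g ∈ A ↔ π g ∈ starPlane p q := by
  classical
  obtain ⟨ψ, e, ρ, he, hψ, hρ⟩ := exists_equiv_prod_ker hφ
  let F : LinearMap.ker ψ → Finset (Fin 4 → ZMod 2) := fun w =>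
    Finset.univ.filter fun v => e (v, w) ∈ A
  have hFmem (w v) : v ∈ F w ↔ e (v, w) ∈ A := by simp [F]
  have hF : ClebschFibres F := by
    refine ⟨fun x hx => ?_, fun {w w' w''} hw x hx y hy z hz h0 => ?_⟩
    · rw [hFmem, he]
      simpa using hφA x hx
    · rw [hFmem] at hx hy hz
      refine hA _ hx _ hy _ hz ?_
      have hw' : (w : G) + w' + w'' = 0 := by exact_mod_cast congrArg Subtype.val hw
      have hφ0 : φ x + φ y + φ z = 0 := by rw [← map_add, ← map_add, h0, map_zero]
      simp only [he]
      linear_combination (norm := (match_scalars <;> decide)) (1 : ZMod 2) • (hw' + hφ0)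
  have hsum : ∑ w, (F w).card = A.card := by
    have h1 : A.card = ((Finset.univ : Finset ((Fin 4 → ZMod 2) × LinearMap.ker ψ)).filter
        fun p => e p ∈ A).card := by
      refine (Finset.card_bij (fun p _ => e p) (by simp) (fun p _ p' _ h => e.injective h)
        fun g hg => ⟨e.symm g, by simpa, by simp⟩).symm
    rw [h1, Finset.card_filter, Fintype.sum_prod_type_right]
    exact Finset.sum_congr rfl fun w _ => Finset.card_filter _ _
  have hG : Fintype.card G = 16 * Fintype.card (LinearMap.ker ψ) := by
    rw [← Fintype.card_congr e, Fintype.card_prod, Fintype.card_fun, ZMod.card, Fintype.card_fin]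
    norm_num
  have hlift (C : LinearMap.ker ψ →+ (Fin 4 → ZMod 2)) :
      ∃ π : G →ₗ[ZMod 2] (Fin 4 → ZMod 2), ∀ p, π (e p) = C p.2 + p.1 :=
    ⟨C.toZModLinearMap 2 ∘ₗ ρ + ψ, fun p => by
      rw [LinearMap.add_apply, LinearMap.comp_apply, hψ, hρ, AddMonoidHom.coe_toZModLinearMap]⟩
  rcases hF.exists_hom (by omega) with ⟨C, hC⟩ | ⟨C, χ, hχ, p, hp, q, hq, hpq, hC⟩
  · left
    obtain ⟨π, hπ⟩ := hlift C
    refine ⟨π, fun v => ⟨e (v, 0), by simp [hπ]⟩, fun a ha => ?_⟩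
    obtain ⟨⟨v, w⟩, rfl⟩ := e.surjective a
    rw [hπ]
    exact hC w v ((hFmem w v).2 ha)
  · right
    obtain ⟨π, hπ⟩ := hlift C
    have hπ' (x) : (π.prod (χ.toZModLinearMap 2 ∘ₗ ρ)) (e x) = (C x.2 + x.1, χ x.2) := by
      refine Prod.ext (hπ x) ?_
      change χ (ρ (e x)) = χ x.2
      rw [hρ]
    refine ⟨π.prod (χ.toZModLinearMap 2 ∘ₗ ρ), fun ⟨v, b⟩ => ?_, p, hp, q, hq, hpq, fun g => ?_⟩
    · obtain ⟨w, rfl⟩ := hχ b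
      refine ⟨e (C w + v, w), ?_⟩
      rw [hπ', ← add_assoc, ZModModule.add_self, zero_add]
    · obtain ⟨⟨v, w⟩, rfl⟩ := e.surjective g
      rw [hπ', ← hFmem, hC]
      simp [starPlane]

/-- A sum-free set of density at least `9 / 32` is bipartite, a projection of `fiveHalf`, or the
preimage of `starPlane p q`. -/
theorem structure_of_sumFree [Fintype G] [DecidableEq G] {A : Finset G}
    (hA : ∀ a ∈ A, ∀ b ∈ A, ∀ c ∈ A, a + b + c ≠ 0) (hcard : 9 * Fintype.card G ≤ 32 * A.card) :
    (∃ f : G →ₗ[ZMod 2] ZMod 2, ∀ a ∈ A, f a = 1) ∨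
    (∃ π : G →ₗ[ZMod 2] (Fin 4 → ZMod 2), Function.Surjective π ∧ ∀ a ∈ A, π a ∈ fiveHalf) ∨
      ∃ π : G →ₗ[ZMod 2] (Fin 4 → ZMod 2) × ZMod 2, Function.Surjective π ∧
        ∃ p ∈ fiveDist2, ∃ q ∈ fiveDist2, p + q ∈ fiveDist2 ∧ ∀ g, g ∈ A ↔ π g ∈ starPlane p q := by
  refine (exists_functional_or_odd A).imp_right fun h => ?_
  have hpos : 0 < Fintype.card G := Fintype.card_pos
  obtain ⟨φ, hφ, hφA⟩ := exists_embedding_of_five_circuit hA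
    (exists_five_circuit hA (by omega) h)
  exact structure_of_embedding hA hcard hφ hφA

end Structure

/-! ### Zero-sum subsets and energy -/

section Energy

set_option linter.unusedSectionVars false

variable {G : Type*} [AddCommGroup G] [DecidableEq G]

/-- The number of `k`-element subsets of `S` with sum `v`. -/
def sumCount (S : Finset G) (k : ℕ) (v : G) : ℕ :=
  ((S.powersetCard k).filter fun T => T.sum id = v).card

/-- The number of triples in `S` whose sum is in `S`. -/
def energy (S : Finset G) : ℕ :=
  ∑ a ∈ S, ∑ b ∈ S, ∑ c ∈ S, if a + b + c ∈ S then 1 else 0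

theorem sum_card_filter_mem_eq (S : Finset G) (k : ℕ) (v : G) :
    ∑ x ∈ S, (((S.powersetCard k).filter fun T => T.sum id = v).filter fun T => x ∈ T).card =
      k * sumCount S k v := by
  rw [sumCount, mul_comm, ← smul_eq_mul, ← Finset.sum_const]
  refine (Finset.sum_card_bipartiteAbove_eq_sum_card_bipartiteBelow
    (s := S) (t := (S.powersetCard k).filter fun T => T.sum id = v) fun x T => x ∈ T).trans
    (Finset.sum_congr rfl fun T hT => ?_)
  obtain ⟨hTS, hTk⟩ := Finset.mem_powersetCard.1 (Finset.mem_filter.1 hT).1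
  rw [← hTk]
  congr 1
  ext x
  simpa [Finset.bipartiteBelow] using @hTS x

theorem card_filter_mem_eq (S : Finset G) (k : ℕ) (v : G) {x : G} (hx : x ∈ S) :
    (((S.powersetCard (k + 1)).filter fun T => T.sum id = v).filter fun T => x ∈ T).card =
      sumCount (S.erase x) k (v - x) := by
  refine Finset.card_nbij' (fun T => T.erase x) (fun T => insert x T) ?_ ?_ ?_ ?_
  · intro T hT
    simp only [Finset.coe_filter, Finset.mem_filter, Finset.mem_powersetCard,
      Set.mem_ofPred_eq] at hT ⊢
    obtain ⟨⟨⟨hTS, hTk⟩, hsum⟩, hxT⟩ := hT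
    refine ⟨⟨Finset.erase_subset_erase x hTS, by rw [Finset.card_erase_of_mem hxT, hTk]; rfl⟩, ?_⟩
    rw [eq_sub_iff_add_eq, ← hsum]
    exact Finset.sum_erase_add T id hxT
  · intro T hT
    simp only [Finset.coe_filter, Finset.mem_filter, Finset.mem_powersetCard,
      Set.mem_ofPred_eq] at hT ⊢
    obtain ⟨⟨hTS, hTk⟩, hsum⟩ := hT
    have hxT : x ∉ T := fun h => (Finset.mem_erase.1 (hTS h)).1 rfl
    refine ⟨⟨⟨Finset.insert_subset hx (hTS.trans (Finset.erase_subset x S)),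
      by rw [Finset.card_insert_of_notMem hxT, hTk]⟩, ?_⟩, Finset.mem_insert_self x T⟩
    rw [Finset.sum_insert hxT, hsum, id, add_sub_cancel]
  · intro T hT
    exact Finset.insert_erase (Finset.mem_filter.1 hT).2
  · intro T hT
    refine Finset.erase_insert fun h => ?_
    exact (Finset.mem_erase.1 ((Finset.mem_powersetCard.1 (Finset.mem_filter.1 hT).1).1 h)).1 rfl

theorem succ_mul_sumCount (S : Finset G) (k : ℕ) (v : G) :
    (k + 1) * sumCount S (k + 1) v = ∑ x ∈ S, sumCount (S.erase x) k (v - x) := by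
  rw [← sum_card_filter_mem_eq]
  exact Finset.sum_congr rfl fun x hx => card_filter_mem_eq S k v hx

theorem sumCount_one (S : Finset G) (v : G) : sumCount S 1 v = if v ∈ S then 1 else 0 := by
  have h := succ_mul_sumCount S 0 v
  rw [zero_add, one_mul] at h
  rw [h, ← Finset.sum_ite_eq' S v fun _ => 1]
  refine Finset.sum_congr rfl fun x _ => ?_
  by_cases hxv : x = v
  · simp [sumCount, hxv, Finset.filter_singleton]
  · have hvx : v - x ≠ 0 := sub_ne_zero.2 (Ne.symm hxv)
    simp [sumCount, hxv, Finset.filter_singleton, hvx.symm]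

/-- Each zero-sum `k`-subset survives the deletion of all but `k` points. -/
theorem sum_sumCount_erase (S : Finset G) (k : ℕ) (v : G) :
    k * sumCount S k v + ∑ x ∈ S, sumCount (S.erase x) k v = S.card * sumCount S k v := by
  rw [← sum_card_filter_mem_eq, ← Finset.sum_add_distrib, ← smul_eq_mul, ← Finset.sum_const]
  refine Finset.sum_congr rfl fun x _ => ?_
  rw [sumCount, sumCount, ← Finset.card_filter_add_card_filter_not
    (s := (S.powersetCard k).filter fun T => T.sum id = v) (p := fun T => x ∈ T)]
  congr 2
  ext T
  simp only [Finset.mem_filter, Finset.mem_powersetCard, Finset.subset_erase]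
  tauto

theorem exists_sumCount_erase_le {S : Finset G} (hS : S.Nonempty) (k : ℕ) (v : G) :
    ∃ x ∈ S, S.card * sumCount (S.erase x) k v + k * sumCount S k v ≤
      S.card * sumCount S k v := by
  by_contra! h
  have h1 := Finset.sum_lt_sum_of_nonempty hS h
  rw [Finset.sum_add_distrib, ← Finset.mul_sum, Finset.sum_const, Finset.sum_const, smul_eq_mul,
    smul_eq_mul, ← Finset.mul_sum, ← mul_add, add_comm, sum_sumCount_erase] at h1
  exact lt_irrefl _ h1

/-- Averaging: some `n`-subset of `M` has at most the expected number of zero-sum `4`-subsets. -/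
theorem exists_subset_sumCount_four_le (M : Finset G) (v : G) (j n : ℕ) (hn : 3 ≤ n)
    (hj : n + j = M.card) :
    ∃ S ⊆ M, S.card = n ∧
      (sumCount S 4 v : ℤ) * (M.card * (M.card - 1) * (M.card - 2) * (M.card - 3)) ≤
        sumCount M 4 v * (n * (n - 1) * (n - 2) * (n - 3)) := by
  induction j generalizing n with
  | zero => exact ⟨M, subset_rfl, by omega, by rw [← hj]; simp⟩
  | succ j ih =>
    obtain ⟨S, hSM, hSn, hS⟩ := ih (n + 1) (by omega) (by omega)
    obtain ⟨x, hx, hle⟩ := exists_sumCount_erase_le (S := S) (Finset.card_pos.1 (by omega)) 4 v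
    refine ⟨S.erase x, (Finset.erase_subset x S).trans hSM,
      by rw [Finset.card_erase_of_mem hx, hSn]; rfl, ?_⟩
    rw [hSn] at hle
    zify at hle hn
    push_cast at hS
    have hm : (3 : ℤ) ≤ M.card := by exact_mod_cast (by omega : 3 ≤ M.card)
    set D : ℤ := M.card * (M.card - 1) * (M.card - 2) * (M.card - 3) with hD
    have hD0 : 0 ≤ D := by
      have h1 : (0 : ℤ) ≤ M.card := by omega
      have h2 : (0 : ℤ) ≤ M.card - 1 := by omega
      have h3 : (0 : ℤ) ≤ M.card - 2 := by omega
      have h4 : (0 : ℤ) ≤ M.card - 3 := by omega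
      positivity
    have h1 : ((n : ℤ) + 1) * sumCount (S.erase x) 4 v ≤ (n - 3) * sumCount S 4 v := by linarith
    have h2 := mul_le_mul_of_nonneg_right h1 hD0
    have h3 := mul_le_mul_of_nonneg_left hS (show (0 : ℤ) ≤ n - 3 by omega)
    refine le_of_mul_le_mul_left (a := (n : ℤ) + 1) ?_ (by omega)
    linarith

theorem sum_eq_erase_erase {S : Finset G} {a b : G} (ha : a ∈ S) (hb : b ∈ S.erase a)
    (f : G → ℕ) : ∑ c ∈ S, f c = ∑ c ∈ (S.erase a).erase b, f c + f b + f a := by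
  rw [Finset.sum_erase_add _ _ hb, Finset.sum_erase_add _ _ ha]

variable [Module (ZMod 2) G]

theorem energy_add_eq (S : Finset G) :
    energy S + 2 * S.card = 24 * sumCount S 4 0 + 3 * S.card ^ 2 := by
  have h24 : 24 * sumCount S 4 0 = ∑ a ∈ S, ∑ b ∈ S.erase a, ∑ c ∈ (S.erase a).erase b,
      if a + b + c ∈ S then 1 else 0 := by
    have h4 := succ_mul_sumCount S 3 0
    have h3 := fun a => succ_mul_sumCount (S.erase a) 2 (0 - a)
    have h2 := fun a b => succ_mul_sumCount ((S.erase a).erase b) 1 (0 - a - b)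
    have : 24 * sumCount S 4 0 = 2 * (3 * ((3 + 1) * sumCount S 4 0)) := by ring
    rw [this, h4, Finset.mul_sum, Finset.mul_sum]
    refine Finset.sum_congr rfl fun a ha => ?_
    rw [show 3 * sumCount (S.erase a) 3 (0 - a) = _ from h3 a, Finset.mul_sum]
    refine Finset.sum_congr rfl fun b hb => ?_
    rw [show 2 * sumCount ((S.erase a).erase b) 2 (0 - a - b) = _ from h2 a b]
    refine Finset.sum_congr rfl fun c hc => ?_
    have hv : 0 - a - b - c = a + b + c := by
      apply eq_of_one_smul; match_scalars <;> decide
    rw [sumCount_one, hv]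
    refine if_congr ?_ rfl rfl
    simp only [Finset.mem_erase] at hb hc ⊢
    refine ⟨fun h => h.2.2.2, fun h => ⟨fun h' => hb.1 ?_, fun h' => hc.2.1 ?_,
      fun h' => hc.1 ?_, h⟩⟩
    · linear_combination (norm := (match_scalars <;> decide)) (1 : ZMod 2) • h'
    · linear_combination (norm := (match_scalars <;> decide)) (1 : ZMod 2) • h'
    · linear_combination (norm := (match_scalars <;> decide)) (1 : ZMod 2) • h'
  have hrow : ∀ a ∈ S, (∑ b ∈ S, ∑ c ∈ S, if a + b + c ∈ S then 1 else 0) + 2 =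
      (∑ b ∈ S.erase a, ∑ c ∈ (S.erase a).erase b, if a + b + c ∈ S then 1 else 0) +
        3 * S.card := by
    intro a ha
    have hpos : 1 ≤ S.card := Finset.card_pos.2 ⟨a, ha⟩
    rw [← Finset.sum_erase_add S _ ha]
    have haa : (∑ c ∈ S, if a + a + c ∈ S then 1 else 0) = S.card := by
      rw [Finset.card_eq_sum_ones]
      refine Finset.sum_congr rfl fun c hc => ?_
      rw [ZModModule.add_self, zero_add, if_pos hc]
    have hb : ∀ b ∈ S.erase a, (∑ c ∈ S, if a + b + c ∈ S then 1 else 0) =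
        (∑ c ∈ (S.erase a).erase b, if a + b + c ∈ S then 1 else 0) + 2 := by
      intro b hb
      rw [sum_eq_erase_erase ha hb, add_assoc a b b, ZModModule.add_self, add_zero, if_pos ha,
        add_right_comm a b a, ZModModule.add_self, zero_add, if_pos (Finset.mem_of_mem_erase hb)]
    rw [haa, Finset.sum_congr rfl hb, Finset.sum_add_distrib, Finset.sum_const,
      Finset.card_erase_of_mem ha, smul_eq_mul]
    omega
  have h := Finset.sum_congr rfl hrow
  rw [Finset.sum_add_distrib, Finset.sum_add_distrib, Finset.sum_const, Finset.sum_const,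
    ← h24, smul_eq_mul, smul_eq_mul] at h
  rw [energy]
  linarith

variable [Fintype G]

theorem exists_fiber_card {H : Type*} [AddCommGroup H] [Module (ZMod 2) H] [Fintype H]
    [DecidableEq H] {π : G →ₗ[ZMod 2] H} (hπ : Function.Surjective π) :
    ∃ κ : ℕ, Fintype.card G = κ * Fintype.card H ∧ ∀ (S : Finset G) (M : Finset H),
      (∀ g, g ∈ S ↔ π g ∈ M) → ∀ f : H → ℕ, ∑ g ∈ S, f (π g) = κ * ∑ h ∈ M, f h := by
  have hfib (h : H) : (Finset.univ.filter fun g => π g = h).card =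
      (Finset.univ.filter fun g => π g = 0).card := by
    obtain ⟨g₀, rfl⟩ := hπ h
    refine Finset.card_nbij' (· - g₀) (· + g₀) ?_ ?_ ?_ ?_
    · intro g hg
      simpa [sub_eq_zero] using hg
    · intro g hg
      simpa using hg
    · intro g _
      simp
    · intro g _
      simp
  have hmain : ∀ (S : Finset G) (M : Finset H), (∀ g, g ∈ S ↔ π g ∈ M) → ∀ f : H → ℕ,
      ∑ g ∈ S, f (π g) = (Finset.univ.filter fun g => π g = 0).card * ∑ h ∈ M, f h := by
    intro S M hSM f
    rw [← Finset.sum_fiberwise_of_maps_to (fun g hg => (hSM g).1 hg), Finset.mul_sum]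
    refine Finset.sum_congr rfl fun h hh => ?_
    rw [← hfib h, ← smul_eq_mul, ← Finset.sum_const]
    refine Finset.sum_congr ?_ fun g hg => by rw [(Finset.mem_filter.1 hg).2]
    ext g
    simp only [Finset.mem_filter, Finset.mem_univ, true_and, hSM]
    exact ⟨fun h => h.2, fun h => ⟨h ▸ hh, h⟩⟩
  refine ⟨_, ?_, hmain⟩
  simpa using hmain Finset.univ Finset.univ (by simp) fun _ => 1

theorem exists_card_energy_preimage {H : Type*} [AddCommGroup H] [Module (ZMod 2) H] [Fintype H]
    [DecidableEq H] {π : G →ₗ[ZMod 2] H} (hπ : Function.Surjective π) {S : Finset G}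
    {M : Finset H} (hS : ∀ g, g ∈ S ↔ π g ∈ M) :
    ∃ κ : ℕ, Fintype.card G = κ * Fintype.card H ∧ S.card = κ * M.card ∧
      energy S = κ ^ 3 * energy M := by
  obtain ⟨κ, hG, hκ⟩ := exists_fiber_card hπ
  refine ⟨κ, hG, by simpa using hκ S M hS fun _ => 1, ?_⟩
  have hc (a b : G) : (∑ c ∈ S, if a + b + c ∈ S then 1 else 0) =
      κ * ∑ z ∈ M, if π a + π b + z ∈ M then 1 else 0 := by
    rw [← hκ S M hS]
    simp only [hS, map_add]
  have hb (a : G) : (∑ b ∈ S, ∑ c ∈ S, if a + b + c ∈ S then 1 else 0) =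
      κ * (κ * ∑ y ∈ M, ∑ z ∈ M, if π a + y + z ∈ M then 1 else 0) := by
    simp only [hc]
    rw [hκ S M hS fun y => κ * ∑ z ∈ M, if π a + y + z ∈ M then 1 else 0, ← Finset.mul_sum]
  have ha : energy S = κ * (κ * (κ * energy M)) := by
    rw [energy]
    simp only [hb]
    rw [hκ S M hS fun x => κ * (κ * ∑ y ∈ M, ∑ z ∈ M, if x + y + z ∈ M then 1 else 0), energy,
      ← Finset.mul_sum, ← Finset.mul_sum]
  rw [ha]
  ring

theorem addEnergy_eq_energy (S : Finset G) : S.addEnergy S = energy S := by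
  have h : energy S = ((S ×ˢ S ×ˢ S).filter fun x => x.1 + x.2.1 + x.2.2 ∈ S).card := by
    rw [energy, Finset.card_filter, Finset.sum_product]
    exact Finset.sum_congr rfl fun a _ =>
      (Finset.sum_product S S fun y => if a + y.1 + y.2 ∈ S then 1 else 0).symm
  rw [h, Finset.addEnergy]
  refine Finset.card_nbij' (fun x => (x.1.1, x.1.2, x.2.1))
    (fun x => ((x.1, x.2.1), x.2.2, x.1 + x.2.1 + x.2.2)) ?_ ?_ ?_ ?_
  · rintro ⟨⟨a, b⟩, c, d⟩ hx
    simp only [Finset.coe_filter, Finset.mem_product, Set.mem_ofPred_eq] at hx ⊢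
    refine ⟨⟨hx.1.1.1, hx.1.1.2, hx.1.2.1⟩, ?_⟩
    convert hx.1.2.2 using 1
    linear_combination (norm := (match_scalars <;> decide)) (1 : ZMod 2) • hx.2
  · rintro ⟨a, b, c⟩ hx
    simp only [Finset.coe_filter, Finset.mem_product, Set.mem_ofPred_eq] at hx ⊢
    refine ⟨⟨⟨hx.1.1, hx.1.2.1⟩, hx.1.2.2, hx.2⟩, ?_⟩
    apply eq_of_one_smul; match_scalars <;> decide
  · rintro ⟨⟨a, b⟩, c, d⟩ hx
    simp only [Finset.coe_filter, Finset.mem_product, Set.mem_ofPred_eq] at hx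
    simp only [Prod.mk.injEq, true_and]
    linear_combination (norm := (match_scalars <;> decide)) (1 : ZMod 2) • hx.2
  · rintro ⟨a, b, c⟩ _
    rfl

/-- The Cauchy–Schwarz bound for a set lying off a hyperplane. -/
theorem two_mul_card_pow_four_le (S : Finset G) {f : G →ₗ[ZMod 2] ZMod 2}
    (hf : ∀ a ∈ S, f a = 1) : 2 * S.card ^ 4 ≤ Fintype.card G * energy S := by
  open scoped Pointwise in
  rcases S.eq_empty_or_nonempty with rfl | ⟨a, ha⟩
  · simp
  have hsurj : Function.Surjective f := by
    intro b
    fin_cases b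
    · exact ⟨0, map_zero f⟩
    · exact ⟨a, hf a ha⟩
  obtain ⟨κ, hG, hκ⟩ := exists_fiber_card hsurj
  have hker : (Finset.univ.filter fun g => f g = 0).card = κ := by
    simpa using hκ (Finset.univ.filter fun g => f g = 0) {0} (by simp) fun _ => 1
  have hsub : S + S ⊆ Finset.univ.filter fun g => f g = 0 := by
    intro x hx
    obtain ⟨a, ha, b, hb, rfl⟩ := Finset.mem_add.1 hx
    simp only [Finset.mem_filter, Finset.mem_univ, true_and, map_add, hf a ha, hf b hb]
    decide
  have h1 := Finset.le_card_add_mul_addEnergy S S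
  have h2 := Finset.card_le_card hsub
  rw [hker] at h2
  rw [addEnergy_eq_energy] at h1
  have h3 := Nat.mul_le_mul_right (energy S) h2
  rw [ZMod.card] at hG
  rw [hG]
  nlinarith

end Energy

/-! ### Energies of the extremal configurations -/

section Extremal

theorem energy_fiveHalf : energy fiveHalf = 65 := by decide +kernel

theorem count_star_star_plane : ∀ p ∈ fiveDist2, ∀ q ∈ fiveDist2, p + q ∈ fiveDist2 →
    (∑ a ∈ fiveHalf, ∑ b ∈ fiveHalf, ∑ c ∈ ({0, p, q, p + q} : Finset (Fin 4 → ZMod 2)),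
      if a + b + c ∈ ({0, p, q, p + q} : Finset (Fin 4 → ZMod 2)) then 1 else 0) = 44 := by
  decide +kernel

theorem count_star_plane_plane : ∀ p ∈ fiveDist2, ∀ q ∈ fiveDist2, p + q ∈ fiveDist2 →
    (∑ a ∈ fiveHalf, ∑ b ∈ ({0, p, q, p + q} : Finset (Fin 4 → ZMod 2)),
      ∑ c ∈ ({0, p, q, p + q} : Finset (Fin 4 → ZMod 2)),
      if a + b + c ∈ fiveHalf then 1 else 0) = 44 := by
  decide +kernel

theorem count_plane_plane_plane : ∀ p ∈ fiveDist2, ∀ q ∈ fiveDist2, p + q ∈ fiveDist2 →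
    (∑ a ∈ ({0, p, q, p + q} : Finset (Fin 4 → ZMod 2)),
      ∑ b ∈ ({0, p, q, p + q} : Finset (Fin 4 → ZMod 2)),
      ∑ c ∈ ({0, p, q, p + q} : Finset (Fin 4 → ZMod 2)),
      if a + b + c ∈ ({0, p, q, p + q} : Finset (Fin 4 → ZMod 2)) then 1 else 0) = 64 := by
  decide +kernel

theorem mk_zero_mem_starPlane {p q v : Fin 4 → ZMod 2} :
    (v, (0 : ZMod 2)) ∈ starPlane p q ↔ v ∈ fiveHalf := by
  simp [starPlane]

theorem mk_one_mem_starPlane {p q v : Fin 4 → ZMod 2} :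
    (v, (1 : ZMod 2)) ∈ starPlane p q ↔ v ∈ ({0, p, q, p + q} : Finset (Fin 4 → ZMod 2)) := by
  simp [starPlane]

theorem sum_starPlane (p q : Fin 4 → ZMod 2) (f : (Fin 4 → ZMod 2) × ZMod 2 → ℕ) :
    ∑ x ∈ starPlane p q, f x = ∑ a ∈ fiveHalf, f (a, 0) +
      ∑ a ∈ ({0, p, q, p + q} : Finset (Fin 4 → ZMod 2)), f (a, 1) := by
  have h : starPlane p q = fiveHalf ×ˢ {0} ∪
      ({0, p, q, p + q} : Finset (Fin 4 → ZMod 2)) ×ˢ {1} := by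
    ext x
    simp only [starPlane, Finset.mem_filter, Finset.mem_univ, true_and, Finset.mem_union,
      Finset.mem_product, Finset.mem_singleton]
    tauto
  rw [h, Finset.sum_union, Finset.sum_product, Finset.sum_product]
  · simp only [Finset.sum_singleton]
  · rw [Finset.disjoint_left]
    rintro ⟨v, b⟩ h0 h1
    rw [Finset.mem_product, Finset.mem_singleton] at h0 h1
    exact absurd (h0.2.symm.trans h1.2) (by decide)

theorem card_starPlane {p q : Fin 4 → ZMod 2} (hp : p ∈ fiveDist2) (hq : q ∈ fiveDist2)
    (hpq : p + q ∈ fiveDist2) : (starPlane p q).card = 9 := by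
  have h1 := card_plane p hp q hq hpq
  have h2 := card_fiveHalf
  rw [Finset.card_eq_sum_ones] at h1 h2 ⊢
  rw [sum_starPlane, h1, h2]

theorem energy_starPlane {p q : Fin 4 → ZMod 2} (hp : p ∈ fiveDist2) (hq : q ∈ fiveDist2)
    (hpq : p + q ∈ fiveDist2) : energy (starPlane p q) = 393 := by
  have h1 := energy_fiveHalf
  have h2 := count_star_star_plane p hp q hq hpq
  have h3 := count_star_plane_plane p hp q hq hpq
  have h4 := count_plane_plane_plane p hp q hq hpq
  have h11 : (1 : ZMod 2) + 1 = 0 := by decide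
  simp only [energy, sum_starPlane, Prod.mk_add_mk, add_zero, zero_add, h11, mk_zero_mem_starPlane,
    mk_one_mem_starPlane, Finset.sum_add_distrib] at h1 ⊢
  set P : Finset (Fin 4 → ZMod 2) := {0, p, q, p + q} with hP
  have h2' : (∑ a ∈ fiveHalf, ∑ b ∈ P, ∑ c ∈ fiveHalf, if a + b + c ∈ P then 1 else 0) = 44 := by
    rw [← h2]
    refine Finset.sum_congr rfl fun a _ => ?_
    rw [Finset.sum_comm]
    simp only [add_right_comm a]
  have h2'' : (∑ a ∈ P, ∑ b ∈ fiveHalf, ∑ c ∈ fiveHalf, if a + b + c ∈ P then 1 else 0) = 44 := by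
    rw [← h2', Finset.sum_comm]
    simp only [add_comm]
  have h3' : (∑ a ∈ P, ∑ b ∈ fiveHalf, ∑ c ∈ P, if a + b + c ∈ fiveHalf then 1 else 0) = 44 := by
    rw [← h3, Finset.sum_comm]
    simp only [add_comm]
  have h3'' : (∑ a ∈ P, ∑ b ∈ P, ∑ c ∈ fiveHalf, if a + b + c ∈ fiveHalf then 1 else 0) = 44 := by
    rw [← h3']
    refine Finset.sum_congr rfl fun a _ => ?_
    rw [Finset.sum_comm]
    simp only [add_right_comm a]
  omega

theorem mem_iterDouble {d : ℕ} (S : Finset (Fin d → ZMod 2)) (t : ℕ) (v : Fin (d + t) → ZMod 2) :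
    v ∈ iterDouble S t ↔ (fun i => v (Fin.castAdd t i)) ∈ S := by
  induction t with
  | zero => rfl
  | succ t ih =>
    have h : v ∈ iterDouble S (t + 1) ↔ Fin.init (n := d + t) v ∈ iterDouble S t := by
      simp only [iterDouble, double, Finset.mem_union, Finset.mem_image]
      constructor
      · rintro (⟨u, hu, rfl⟩ | ⟨u, hu, rfl⟩) <;> rwa [Fin.init_snoc]
      · intro h
        obtain hv | hv : v (Fin.last (d + t)) = 0 ∨ v (Fin.last (d + t)) = 1 := by
          generalize v (Fin.last (d + t)) = x
          revert x
          decide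
        · exact Or.inl ⟨_, h, by rw [← hv]; exact Fin.snoc_init_self v⟩
        · exact Or.inr ⟨_, h, by rw [← hv]; exact Fin.snoc_init_self v⟩
    rw [h, ih]
    rfl

/-- The restriction to the first `d` coordinates. -/
def initCoords (d t : ℕ) : (Fin (d + t) → ZMod 2) →ₗ[ZMod 2] (Fin d → ZMod 2) :=
  LinearMap.funLeft (ZMod 2) (ZMod 2) (Fin.castAdd t)

theorem initCoords_surjective (d t : ℕ) : Function.Surjective (initCoords d t) :=
  LinearMap.funLeft_surjective_of_injective _ _ _ (Fin.castAdd_injective d t)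

theorem exists_linearEquiv_comp_eq {K V U : Type*} [Field K] [AddCommGroup V] [Module K V]
    [FiniteDimensional K V] [AddCommGroup U] [Module K U] {π π' : V →ₗ[K] U}
    (hπ : Function.Surjective π) (hπ' : Function.Surjective π') :
    ∃ g : V ≃ₗ[K] V, ∀ v, π' (g v) = π v := by
  have hprod : ∀ f : V →ₗ[K] U, Function.Surjective f →
      ∃ e : V ≃ₗ[K] U × LinearMap.ker f, ∀ v, (e v).1 = f v := by
    intro f hf
    obtain ⟨Q, hQ⟩ := Submodule.exists_isCompl (LinearMap.ker f)
    exact ⟨LinearMap.equivProdOfSurjectiveOfIsCompl f (Submodule.projectionOnto _ Q hQ)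
      (LinearMap.range_eq_top.2 hf) (Submodule.range_projectionOnto hQ)
      (by rwa [Submodule.ker_projectionOnto]), fun v => rfl⟩
  obtain ⟨e, he⟩ := hprod π hπ
  obtain ⟨e', he'⟩ := hprod π' hπ'
  have hr := LinearMap.finrank_range_add_finrank_ker π
  have hr' := LinearMap.finrank_range_add_finrank_ker π'
  rw [LinearMap.range_eq_top.2 hπ] at hr
  rw [LinearMap.range_eq_top.2 hπ'] at hr'
  let κ : LinearMap.ker π ≃ₗ[K] LinearMap.ker π' := LinearEquiv.ofFinrankEq _ _ (by omega)
  refine ⟨e ≪≫ₗ (LinearEquiv.refl K U).prodCongr κ ≪≫ₗ e'.symm, fun v => ?_⟩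
  rw [← he', ← he]
  simp

end Extremal

/-! ### Comparison with the iterated double -/

section Comparison

theorem bipartite_bound {T n : ℤ} (hT : 2 ≤ T) (hn : 9 * T ≤ 2 * n) :
    8 * T * ((T - 1) * (13 * T - 2)) * ((n - 1) * (n - 2) * (n - 3)) <
      (n ^ 3 - 24 * T * n + 16 * T) * ((5 * T - 1) * (5 * T - 2) * (5 * T - 3)) := by
  obtain ⟨u, hu, rfl⟩ : ∃ u : ℤ, 0 ≤ u ∧ T = 2 + u := ⟨T - 2, by omega, by ring⟩
  obtain ⟨k, hk, h⟩ : ∃ k : ℤ, 0 ≤ k ∧ 2 * n = 9 * (2 + u) + k :=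
    ⟨2 * n - 9 * (2 + u), by omega, by ring⟩
  have h8 : 0 < ((9 * (2 + u) + k) ^ 3 - 96 * (2 + u) * (9 * (2 + u) + k) + 128 * (2 + u)) *
      ((5 * (2 + u) - 1) * (5 * (2 + u) - 2) * (5 * (2 + u) - 3)) -
      8 * (2 + u) * ((2 + u - 1) * (13 * (2 + u) - 2)) *
        ((9 * (2 + u) + k - 2) * (9 * (2 + u) + k - 4) * (9 * (2 + u) + k - 6)) := by
    ring_nf
    positivity
  rw [← h] at h8
  linarith

theorem star_plane_bound {κ : ℤ} (hκ : 1 ≤ κ) :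
    (65 * (2 * κ) ^ 3 + 10 * (2 * κ) - 75 * (2 * κ) ^ 2) *
        (9 * κ * (9 * κ - 1) * (9 * κ - 2) * (9 * κ - 3)) <
      (393 * κ ^ 3 + 18 * κ - 243 * κ ^ 2) *
        (10 * κ * (10 * κ - 1) * (10 * κ - 2) * (10 * κ - 3)) := by
  obtain ⟨u, hu, rfl⟩ : ∃ u : ℤ, 0 ≤ u ∧ κ = 1 + u := ⟨κ - 1, by omega, by ring⟩
  rw [← sub_pos]
  ring_nf
  positivity

theorem zero_notMem_fiveHalf : (0 : Fin 4 → ZMod 2) ∉ fiveHalf := by decide +kernel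

theorem sumFree_fiveHalf :
    ∀ a ∈ fiveHalf, ∀ b ∈ fiveHalf, ∀ c ∈ fiveHalf, a + b + c ≠ 0 := by decide +kernel

theorem card_energy_iterDouble (t : ℕ) :
    (iterDouble fiveHalf t).card = 5 * 2 ^ t ∧
      energy (iterDouble fiveHalf t) = 65 * (2 ^ t) ^ 3 := by
  obtain ⟨κ, h1, h2, h3⟩ := exists_card_energy_preimage (initCoords_surjective 4 t)
    (mem_iterDouble fiveHalf t)
  obtain rfl : κ = 2 ^ t := by
    simp only [Fintype.card_fun, ZMod.card, Fintype.card_fin, pow_add, mul_comm] at h1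
    omega
  rw [h2, h3, card_fiveHalf, energy_fiveHalf, mul_comm, mul_comm 65]
  exact ⟨rfl, rfl⟩

theorem sumFree_iterDouble (t : ℕ) : ∀ a ∈ iterDouble fiveHalf t, ∀ b ∈ iterDouble fiveHalf t,
    ∀ c ∈ iterDouble fiveHalf t, a + b + c ≠ 0 := by
  intro a ha b hb c hc h
  rw [mem_iterDouble] at ha hb hc
  exact sumFree_fiveHalf _ ha _ hb _ hc (funext fun i => congrFun h (Fin.castAdd t i))

variable {d : ℕ} {S : Finset (Fin d → ZMod 2)}

theorem wordCount_one (h0 : ∀ v ∈ S, v ≠ 0) : wordCount S 1 = 0 := by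
  rw [wordCount, Finset.card_eq_zero, Finset.filter_eq_empty_iff]
  intro T hT h
  rw [Finset.mem_powersetCard, Finset.card_eq_one] at hT
  obtain ⟨hTS, a, rfl⟩ := hT
  rw [Finset.sum_singleton] at h
  exact h0 a (hTS (Finset.mem_singleton_self a)) h

theorem wordCount_two : wordCount S 2 = 0 := by
  rw [wordCount, Finset.card_eq_zero, Finset.filter_eq_empty_iff]
  intro T hT h
  rw [Finset.mem_powersetCard, Finset.card_eq_two] at hT
  obtain ⟨-, a, b, hab, rfl⟩ := hT
  rw [Finset.sum_pair hab, id, id] at h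
  refine hab ?_
  linear_combination (norm := (match_scalars <;> decide)) (1 : ZMod 2) • h

theorem wordCount_three (h0 : ∀ v ∈ S, v ≠ 0) :
    wordCount S 3 = 0 ↔ ∀ a ∈ S, ∀ b ∈ S, ∀ c ∈ S, a + b + c ≠ 0 := by
  rw [wordCount, Finset.card_eq_zero, Finset.filter_eq_empty_iff]
  constructor
  · intro h a ha b hb c hc habc
    have hab : a ≠ b := by
      rintro rfl
      refine h0 c hc ?_
      linear_combination (norm := (match_scalars <;> decide)) (1 : ZMod 2) • habc
    have hac : a ≠ c := by
      rintro rfl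
      refine h0 b hb ?_
      linear_combination (norm := (match_scalars <;> decide)) (1 : ZMod 2) • habc
    have hbc : b ≠ c := by
      rintro rfl
      refine h0 a ha ?_
      linear_combination (norm := (match_scalars <;> decide)) (1 : ZMod 2) • habc
    refine h (x := {a, b, c}) ?_ ?_
    · rw [Finset.mem_powersetCard, Finset.card_eq_three]
      refine ⟨?_, a, b, c, hab, hac, hbc, rfl⟩
      simp [Finset.insert_subset_iff, ha, hb, hc]
    · rw [Finset.sum_insert (by simp [hab, hac]), Finset.sum_pair hbc, ← add_assoc]
      exact habc
  · intro h T hT hsum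
    rw [Finset.mem_powersetCard, Finset.card_eq_three] at hT
    obtain ⟨hTS, a, b, c, hab, hac, hbc, rfl⟩ := hT
    rw [Finset.sum_insert (by simp [hab, hac]), Finset.sum_pair hbc, ← add_assoc] at hsum
    exact h a (hTS (by simp)) b (hTS (by simp)) c (hTS (by simp)) hsum

/-- A minimum aberration design is a cap with few words of length four. -/
theorem sumFree_and_wordCount_four_le {t n : ℕ} (h3 : 4 ≤ n) (hn : n ≤ 5 * 2 ^ t)
    (S : Finset (Fin (4 + t) → ZMod 2)) (hS : ∀ v ∈ S, v ≠ 0)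
    (hma : ∀ S' : Finset (Fin (4 + t) → ZMod 2), (∀ v ∈ S', v ≠ 0) → S'.card = n →
      ∀ k, 1 ≤ k → k ≤ n → (∀ j, 1 ≤ j → j < k → wordCount S j = wordCount S' j) →
        wordCount S k ≤ wordCount S' k) :
    (∀ a ∈ S, ∀ b ∈ S, ∀ c ∈ S, a + b + c ≠ 0) ∧
      (24 * wordCount S 4 : ℤ) * (5 * 2 ^ t * (5 * 2 ^ t - 1) * (5 * 2 ^ t - 2) * (5 * 2 ^ t - 3)) ≤
        (65 * (2 ^ t) ^ 3 + 10 * 2 ^ t - 75 * (2 ^ t) ^ 2) * (n * (n - 1) * (n - 2) * (n - 3)) := by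
  obtain ⟨hM, hE⟩ := card_energy_iterDouble t
  obtain ⟨S', hS'M, hS'n, hS'⟩ := exists_subset_sumCount_four_le (iterDouble fiveHalf t) 0
    (5 * 2 ^ t - n) n (by omega) (by omega)
  have h0 : ∀ v ∈ S', v ≠ 0 := by
    rintro _ hv rfl
    exact zero_notMem_fiveHalf ((mem_iterDouble _ _ _).1 (hS'M hv))
  have hS'3 : wordCount S' 3 = 0 := (wordCount_three h0).2 fun a ha b hb c hc =>
    sumFree_iterDouble t a (hS'M ha) b (hS'M hb) c (hS'M hc)
  have hS3 : wordCount S 3 = 0 := by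
    rw [← Nat.le_zero, ← hS'3]
    refine hma S' h0 hS'n 3 (by omega) (by omega) fun j hj1 hj3 => ?_
    interval_cases j
    · rw [wordCount_one hS, wordCount_one h0]
    · rw [wordCount_two, wordCount_two]
  have h4 : wordCount S 4 ≤ wordCount S' 4 := by
    refine hma S' h0 hS'n 4 (by omega) h3 fun j hj1 hj4 => ?_
    interval_cases j
    · rw [wordCount_one hS, wordCount_one h0]
    · rw [wordCount_two, wordCount_two]
    · rw [hS3, hS'3]
  refine ⟨(wordCount_three hS).1 hS3, ?_⟩
  have hen := energy_add_eq (iterDouble fiveHalf t)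
  rw [hM, hE] at hen
  rw [hM] at hS'
  change (wordCount S' 4 : ℤ) * _ ≤ _ at hS'
  zify at hen h4
  push_cast at hS'
  have hT : (1 : ℤ) ≤ 2 ^ t := one_le_pow₀ (by norm_num)
  generalize (2 : ℤ) ^ t = T at *
  have hD : 0 ≤ 5 * T * (5 * T - 1) * (5 * T - 2) * (5 * T - 3) := by
    have h1 : 0 ≤ 5 * T := by omega
    have h2 : 0 ≤ 5 * T - 1 := by omega
    have h3 : 0 ≤ 5 * T - 2 := by omega
    have h4 : 0 ≤ 5 * T - 3 := by omega
    positivity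
  have h5 := mul_le_mul_of_nonneg_right h4 hD
  have h6 : 65 * T ^ 3 + 10 * T - 75 * T ^ 2 =
      24 * (sumCount (iterDouble fiveHalf t) 4 0 : ℤ) := by linarith
  rw [h6]
  linarith

end Comparison

-- Theorem 4.1 (with the run-size exponent written as d = 4 + t, t ≥ 1, N = 2^(4+t),
-- so 9N/32 = 9·2^(t-1) and 5N/16 = 5·2^t): if S is a design with n factors,
-- 9N/32 ≤ n ≤ 5N/16, having minimum aberration (its wordlength pattern is
-- lexicographically ≤ that of every design with n factors and the same run size),
-- then, up to a linear automorphism, S is a projection of D^t(fiveHalf), the design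
-- obtained by repeatedly doubling the 2^{5-1} design defined by I = ABCDE.
theorem minimum_aberration_projection (t : ℕ) (ht : 1 ≤ t) (n : ℕ)
    (hn1 : 9 * 2 ^ (t - 1) ≤ n) (hn2 : n ≤ 5 * 2 ^ t)
    (S : Finset (Fin (4 + t) → ZMod 2)) (hS : ∀ v ∈ S, v ≠ 0) (hcard : S.card = n)
    (hma : ∀ S' : Finset (Fin (4 + t) → ZMod 2), (∀ v ∈ S', v ≠ 0) → S'.card = n →
      ∀ k, 1 ≤ k → k ≤ n → (∀ j, 1 ≤ j → j < k → wordCount S j = wordCount S' j) →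
        wordCount S k ≤ wordCount S' k) :
    ∃ g : (Fin (4 + t) → ZMod 2) ≃ₗ[ZMod 2] (Fin (4 + t) → ZMod 2),
      S.image g ⊆ iterDouble fiveHalf t := by
  have hT : 2 ^ t = 2 * 2 ^ (t - 1) := by
    rw [← pow_succ', Nat.sub_add_cancel ht]
  have hpos : 1 ≤ 2 ^ (t - 1) := Nat.one_le_two_pow
  have hG : Fintype.card (Fin (4 + t) → ZMod 2) = 16 * 2 ^ t := by
    simp only [Fintype.card_fun, ZMod.card, Fintype.card_fin, pow_add]
    norm_num
  obtain ⟨hfree, hle⟩ := sumFree_and_wordCount_four_le (by omega) hn2 S hS hma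
  have hen := energy_add_eq S
  rw [hcard] at hen
  change _ = 24 * wordCount S 4 + _ at hen
  have hT2 : (2 : ℤ) ≤ 2 ^ t := by exact_mod_cast (by omega : 2 ≤ 2 ^ t)
  have hnT : (9 : ℤ) * 2 ^ t ≤ 2 * n := by exact_mod_cast (by omega : 9 * 2 ^ t ≤ 2 * n)
  zify at hen
  have hw : (24 * wordCount S 4 : ℤ) = energy S + 2 * n - 3 * n ^ 2 := by linarith
  rw [hw] at hle
  obtain ⟨f, hf⟩ | ⟨π, hπ, hA⟩ | ⟨π, hπ, p, hp, q, hq, hpq, hA⟩ :=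
    structure_of_sumFree hfree (by rw [hG, hcard]; omega)
  · have hE := two_mul_card_pow_four_le S hf
    rw [hG, hcard] at hE
    zify at hE
    have hb := bipartite_bound hT2 hnT
    generalize (2 : ℤ) ^ t = T at *
    generalize (n : ℤ) = m at *
    have hm : 0 < m := by omega
    have hD : 0 ≤ 5 * T * (5 * T - 1) * (5 * T - 2) * (5 * T - 3) := by
      have h1 : 0 ≤ 5 * T := by omega
      have h2 : 0 ≤ 5 * T - 1 := by omega
      have h3 : 0 ≤ 5 * T - 2 := by omega
      have h4 : 0 ≤ 5 * T - 3 := by omega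
      positivity
    have h1 : m * (m ^ 3 - 24 * T * m + 16 * T) ≤ 8 * T * (energy S + 2 * m - 3 * m ^ 2) := by
      linarith
    have h2 := mul_le_mul_of_nonneg_right h1 hD
    have h3 := mul_le_mul_of_nonneg_left hle (show 0 ≤ 8 * T by omega)
    have h4 := mul_lt_mul_of_pos_left hb (show 0 < 5 * T * m by positivity)
    linarith
  · obtain ⟨g, hg⟩ := exists_linearEquiv_comp_eq hπ (initCoords_surjective 4 t)
    refine ⟨g, fun v hv => ?_⟩
    obtain ⟨a, ha, rfl⟩ := Finset.mem_image.1 hv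
    rw [mem_iterDouble]
    change initCoords 4 t (g a) ∈ fiveHalf
    rw [hg]
    exact hA a ha
  · obtain ⟨κ, h1, h2, h3⟩ := exists_card_energy_preimage hπ hA
    rw [hG, Fintype.card_prod, ZMod.card, Fintype.card_fun, ZMod.card, Fintype.card_fin] at h1
    rw [hcard, card_starPlane hp hq hpq] at h2
    rw [energy_starPlane hp hq hpq] at h3
    obtain hκT : 2 ^ t = 2 * κ := by omega
    have hb := star_plane_bound (κ := (κ : ℤ)) (by omega)
    zify at h2 h3 hκT
    rw [h2, h3, hκT] at hle
    linarith
end
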